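/- arXiv:1111.1320 — 2 statements merged into one kernel-verified Lean document; each statement's English description precedes it below -/
import Mathlib

section
/- Let ONH_a be the subring of the additive endomorphism ring of OPol_a generated by the left multiplication operators x_1,…,x_a and the odd divided difference operators ∂_1,…,∂_{a−1}. Every element of ONH_a is right OΛ_a-linear, and ONH_a equals the full endomorphism ring End_{OΛ_a}(OPol_a) of OPol_a viewed as a right OΛ_a-module. In particular, since OPol_a is a free right OΛ_a-module of rank a!, the ring ONH_a is isomorphic to the ring of a! × a! matrices over OΛ_a. -/
open scoped BigOperators

/-- The defining anticommutation relations of the odd polynomial ring. -/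
inductive OddRel (a : ℕ) : FreeAlgebra ℤ (Fin a) → FreeAlgebra ℤ (Fin a) → Prop
  | anticomm (i j : Fin a) (h : i ≠ j) :
      OddRel a (FreeAlgebra.ι ℤ i * FreeAlgebra.ι ℤ j)
        (-(FreeAlgebra.ι ℤ j * FreeAlgebra.ι ℤ i))

/-- The ring of odd polynomials in `a` variables over `ℤ`. -/
abbrev OPol (a : ℕ) : Type := RingQuot (OddRel a)

/-- The variable `x_{i+1}` (`0`-based index). -/
noncomputable def OX {a : ℕ} (i : Fin a) : OPol a :=
  RingQuot.mkRingHom (OddRel a) (FreeAlgebra.ι ℤ i)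

/-- The variable `x_i` (`1`-based index), `0` if out of range. -/
noncomputable def xv (a : ℕ) (i : ℕ) : OPol a :=
  if h : 1 ≤ i ∧ i ≤ a then OX ⟨i - 1, by omega⟩ else 0

/-- The signed variable `x̃_i = (−1)^{i−1} x_i` (`0`-based index, so the sign is `(−1)^i`). -/
noncomputable def xt (a : ℕ) (i : Fin a) : OPol a := (-1 : OPol a) ^ (i : ℕ) * OX i

/-- Odd elementary symmetric polynomial `ε_k`. -/
noncomputable def eps (a k : ℕ) : OPol a :=
  ∑ t ∈ Finset.powersetCard k (Finset.univ : Finset (Fin a)),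
    ((t.sort (· ≤ ·)).map (xt a)).prod

/-- Odd complete symmetric polynomial `h_k`. -/
noncomputable def hp (a k : ℕ) : OPol a :=
  ∑ σ : Sym (Fin a) k, (((σ : Multiset (Fin a)).sort (· ≤ ·)).map (xt a)).prod

/-- The ordered monomial `x_1^{c_1} ⋯ x_a^{c_a}`. -/
noncomputable def xmon {a : ℕ} (c : Fin a → ℕ) : OPol a :=
  ((List.finRange a).map fun i => OX i ^ c i).prod

/-- The staircase monomial `x^{δ_a} = x_1^{a−1} x_2^{a−2} ⋯ x_a^0`. -/
noncomputable def xdelta (a : ℕ) : OPol a :=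
  ((List.finRange a).map fun i => OX i ^ (a - 1 - (i : ℕ))).prod

/-- Composite of the operators `d i` along a word, leftmost letter acting last (outermost). -/
noncomputable def dword {a : ℕ} (d : ℕ → OPol a →+ OPol a) : List ℕ → (OPol a →+ OPol a)
  | [] => AddMonoidHom.id _
  | i :: l => (d i).comp (dword d l)

/-- The word `1, (2,1), (3,2,1), …, (a−1,…,2,1)` for the longest element, so that
`dword d (DList a) = ∂_1∘(∂_2∘∂_1)∘⋯∘(∂_{a−1}∘⋯∘∂_1) = D_a`. -/
def DList (a : ℕ) : List ℕ :=
  ((List.range a).map fun b => (List.range b).reverse.map (· + 1)).flatten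

/-- Left multiplication by `f` as a `ℤ`-linear endomorphism. -/
noncomputable def mulL {a : ℕ} (f : OPol a) : Module.End ℤ (OPol a) :=
  (AddMonoidHom.mulLeft f).toIntLinearMap

/-- The generators of the odd nilHecke ring inside `End_ℤ(OPol a)`. -/
noncomputable def onhGens (a : ℕ) (d : ℕ → OPol a →+ OPol a) :
    Set (Module.End ℤ (OPol a)) :=
  {T | (∃ i : Fin a, T = mulL (OX i)) ∨
    (∃ i : ℕ, 1 ≤ i ∧ i + 1 ≤ a ∧ T = (d i).toIntLinearMap)}

/-- The simple transposition `s_i` (`1`-based) of `{1,…,a}`. -/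
def sperm (a : ℕ) (i : ℕ) : Equiv.Perm (Fin a) :=
  if h : 1 ≤ i ∧ i + 1 ≤ a then Equiv.swap ⟨i - 1, by omega⟩ ⟨i, by omega⟩ else 1

/-- The permutation associated to a word in the simple transpositions. -/
def wordPerm (a : ℕ) (l : List ℕ) : Equiv.Perm (Fin a) := (l.map (sperm a)).prod

/-- Evaluation of an (even) multivariate polynomial at the squared variables `x_1², …, x_a²`. -/
noncomputable def sqEval {a : ℕ} (p : MvPolynomial (Fin a) ℤ) : OPol a :=
  ∑ m ∈ p.support,
    MvPolynomial.coeff m p • ((List.finRange a).map fun i => OX i ^ (2 * m i)).prod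

/-- The odd symmetrization operator `S(f) = (−1)^{C(a,3)} w₀(D_a(f·x^{δ_a}))`. -/
noncomputable def oddSymzn (a : ℕ) (d : ℕ → OPol a →+ OPol a) (W0 : OPol a →+* OPol a)
    (f : OPol a) : OPol a :=
  (-1 : OPol a) ^ Nat.choose a 3 * W0 (dword d (DList a) (f * xdelta a))

/-- The odd Schur polynomial `s_α = (−1)^{C(a,3)} w₀(D_a(x^α·x^{δ_a}))`. -/
noncomputable def schurP (a : ℕ) (d : ℕ → OPol a →+ OPol a) (W0 : OPol a →+* OPol a)
    (α : Fin a → ℕ) : OPol a :=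
  (-1 : OPol a) ^ Nat.choose a 3 * W0 (dword d (DList a) (xmon α * xdelta a))

/-- The 0-Hecke generator `∂̄_r = x_r ∘ ∂_r`. -/
noncomputable def dbar (a : ℕ) (d : ℕ → OPol a →+ OPol a) (r : ℕ) : OPol a →+ OPol a :=
  (AddMonoidHom.mulLeft (xv a r)).comp (d r)

/-- The `ℤ`-span of products of exactly `n` variables: the degree-`2n` component of `OPol a`. -/
def degComp (a n : ℕ) : Submodule ℤ (OPol a) :=
  Submodule.span ℤ {f : OPol a | ∃ l : List (Fin a), l.length = n ∧ f = (l.map OX).prod}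

/-- Odd Schubert polynomial `𝔰_w = ∂_{w⁻¹w₀}(x^{δ_a})` for a fixed choice `red` of
reduced expressions. -/
noncomputable def schubert (a : ℕ) (d : ℕ → OPol a →+ OPol a)
    (red : Equiv.Perm (Fin a) → List ℕ) (w : Equiv.Perm (Fin a)) : OPol a :=
  dword d (red (w⁻¹ * Fin.revPerm)) (xdelta a)

/-- Product of odd elementary symmetric polynomials along the parts of a partition,
in non-increasing order. -/
noncomputable def epsPart (a : ℕ) {n : ℕ} (p : Nat.Partition n) : OPol a :=
  (((p.parts.sort (· ≤ ·)).reverse).map (eps a)).prod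

/-- The ring `R` is generated by `x 1, …, x a`, and the operators `d i`, `1 ≤ i < a`, are odd
divided differences with respect to the ring endomorphisms `s i`. -/
structure IsOddDividedDiff {R : Type*} [Ring R] (a : ℕ) (x : ℕ → R) (s : ℕ → R →+* R)
    (d : ℕ → R →+ R) : Prop where
  closure_eq_top : Subring.closure (x '' Set.Icc 1 a) = ⊤
  s_apply : ∀ i j : ℕ, 1 ≤ i → i + 1 ≤ a → 1 ≤ j → j ≤ a →
    s i (x j) = if j = i then -x (i + 1) else if j = i + 1 then -x i else -x j
  d_one : ∀ i : ℕ, 1 ≤ i → i + 1 ≤ a → d i 1 = 0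
  d_apply : ∀ i j : ℕ, 1 ≤ i → i + 1 ≤ a → 1 ≤ j → j ≤ a →
    d i (x j) = if j = i ∨ j = i + 1 then 1 else 0
  d_mul : ∀ i : ℕ, 1 ≤ i → i + 1 ≤ a → ∀ f g : R, d i (f * g) = d i f * g + s i f * d i g

namespace IsOddDividedDiff

variable {R : Type*} [Ring R] {a : ℕ} {x : ℕ → R} {s : ℕ → R →+* R} {d : ℕ → R →+ R}

theorem induction (h : IsOddDividedDiff a x s d) {P : R → Prop} (one : P 1)
    (var : ∀ j, 1 ≤ j → j ≤ a → P (x j)) (neg : ∀ f, P f → P (-f))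
    (add : ∀ f g, P f → P g → P (f + g)) (mul : ∀ f g, P f → P g → P (f * g)) (f : R) :
    P f := by
  have hf : f ∈ Subring.closure (x '' Set.Icc 1 a) := h.closure_eq_top ▸ trivial
  induction hf using Subring.closure_induction with
  | mem y hy => obtain ⟨j, hj, rfl⟩ := hy; exact var j hj.1 hj.2
  | zero => simpa using add _ _ one (neg _ one)
  | one => exact one
  | add f g _ _ hf hg => exact add f g hf hg
  | neg f _ hf => exact neg f hf
  | mul f g _ _ hf hg => exact mul f g hf hg

theorem d_d_x (h : IsOddDividedDiff a x s d) {i j m : ℕ} (hi : 1 ≤ i) (hia : i + 1 ≤ a)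
    (hj : 1 ≤ j) (hja : j + 1 ≤ a) (hm : 1 ≤ m) (hma : m ≤ a) : d i (d j (x m)) = 0 := by
  rw [h.d_apply j m hj hja hm hma]
  split_ifs
  · exact h.d_one i hi hia
  · exact map_zero _

theorem s_d_x (h : IsOddDividedDiff a x s d) (i : ℕ) {j m : ℕ}
    (hj : 1 ≤ j) (hja : j + 1 ≤ a) (hm : 1 ≤ m) (hma : m ≤ a) :
    s i (d j (x m)) = d j (x m) := by
  rw [h.d_apply j m hj hja hm hma]
  split_ifs <;> simp

theorem s_x_eq_neg (h : IsOddDividedDiff a x s d) {i m : ℕ} (hi : 1 ≤ i) (hia : i + 1 ≤ a)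
    (hm : 1 ≤ m) (hma : m ≤ a) :
    s i (x m) = -x (Equiv.swap i (i + 1) m) ∧
      1 ≤ Equiv.swap i (i + 1) m ∧ Equiv.swap i (i + 1) m ≤ a := by
  rw [h.s_apply i m hi hia hm hma]
  simp only [Equiv.swap_apply_def]
  split_ifs <;> simp <;> omega

theorem s_comm (h : IsOddDividedDiff a x s d) {i j : ℕ} (hi : 1 ≤ i) (hia : i + 1 ≤ a)
    (hj : 1 ≤ j) (hja : j + 1 ≤ a) (hij : i + 1 < j ∨ j + 1 < i) (f : R) :
    s i (s j f) = s j (s i f) := by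
  induction f using h.induction with
  | one => simp
  | var m hm hma =>
    obtain ⟨e, h1, h2⟩ := h.s_x_eq_neg hi hia hm hma
    obtain ⟨e', h1', h2'⟩ := h.s_x_eq_neg hj hja hm hma
    rw [e, e', map_neg, map_neg, (h.s_x_eq_neg hj hja h1 h2).1, (h.s_x_eq_neg hi hia h1' h2').1]
    congr 3
    simp only [Equiv.swap_apply_def]
    grind
  | neg f hf => simp [hf]
  | add f g hf hg => simp [hf, hg]
  | mul f g hf hg => simp [hf, hg]

theorem s_braid (h : IsOddDividedDiff a x s d) {i j : ℕ} (hi : 1 ≤ i) (hia : i + 1 ≤ a)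
    (hj : 1 ≤ j) (hja : j + 1 ≤ a) (hij : i + 1 = j ∨ j + 1 = i) (f : R) :
    s i (s j (s i f)) = s j (s i (s j f)) := by
  induction f using h.induction with
  | one => simp
  | var m hm hma =>
    obtain ⟨e, h1, h2⟩ := h.s_x_eq_neg hi hia hm hma
    obtain ⟨e', h1', h2'⟩ := h.s_x_eq_neg hj hja hm hma
    obtain ⟨e2, h3, h4⟩ := h.s_x_eq_neg hj hja h1 h2
    obtain ⟨e2', h3', h4'⟩ := h.s_x_eq_neg hi hia h1' h2'
    simp only [e, e', map_neg, e2, e2', (h.s_x_eq_neg hi hia h3 h4).1,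
      (h.s_x_eq_neg hj hja h3' h4').1]
    congr 4
    simp only [Equiv.swap_apply_def]
    grind
  | neg f hf => simp [hf]
  | add f g hf hg => simp [hf, hg]
  | mul f g hf hg => simp [hf, hg]

theorem d_s_anticomm (h : IsOddDividedDiff a x s d) {i j : ℕ} (hi : 1 ≤ i) (hia : i + 1 ≤ a)
    (hj : 1 ≤ j) (hja : j + 1 ≤ a) (hij : i = j ∨ i + 1 < j ∨ j + 1 < i) (f : R) :
    d i (s j f) = -s j (d i f) := by
  have hs : ∀ f, s i (s j f) = s j (s i f) := by
    rcases hij with rfl | hij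
    · exact fun _ => rfl
    · exact h.s_comm hi hia hj hja hij
  induction f using h.induction with
  | one => simp [h.d_one i hi hia]
  | var m hm hma =>
    obtain ⟨e, h1, h2⟩ := h.s_x_eq_neg hj hja hm hma
    rw [h.s_d_x j hi hia hm hma, e, map_neg, h.d_apply i m hi hia hm hma, h.d_apply i _ hi hia h1 h2]
    simp only [Equiv.swap_apply_def]
    grind
  | neg f hf => simp [hf]
  | add f g hf hg => simp [hf, hg, add_comm]
  | mul f g hf hg =>
    simp only [map_mul, map_add, h.d_mul i hi hia, hf, hg, hs]
    noncomm_ring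

theorem d_d_self (h : IsOddDividedDiff a x s d) {i : ℕ} (hi : 1 ≤ i) (hia : i + 1 ≤ a) (f : R) :
    d i (d i f) = 0 := by
  induction f using h.induction with
  | one => simp [h.d_one i hi hia]
  | var m hm hma => exact h.d_d_x hi hia hi hia hm hma
  | neg f hf => simp [hf]
  | add f g hf hg => simp [hf, hg]
  | mul f g hf hg =>
    simp [h.d_mul i hi hia, hf, hg, h.d_s_anticomm hi hia hi hia (Or.inl rfl)]

theorem d_anticomm (h : IsOddDividedDiff a x s d) {i j : ℕ} (hi : 1 ≤ i) (hia : i + 1 ≤ a)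
    (hj : 1 ≤ j) (hja : j + 1 ≤ a) (hij : i + 1 < j ∨ j + 1 < i) (f : R) :
    d i (d j f) = -d j (d i f) := by
  induction f using h.induction with
  | one => simp [h.d_one i hi hia, h.d_one j hj hja]
  | var m hm hma => rw [h.d_d_x hi hia hj hja hm hma, h.d_d_x hj hja hi hia hm hma, neg_zero]
  | neg f hf => simp [hf]
  | add f g hf hg => simp [hf, hg, add_comm]
  | mul f g hf hg =>
    simp only [h.d_mul i hi hia, h.d_mul j hj hja, map_add, hf, hg,
      h.d_s_anticomm hi hia hj hja (Or.inr hij),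
      h.d_s_anticomm hj hja hi hia (Or.inr hij.symm), h.s_comm hi hia hj hja hij]
    noncomm_ring

theorem s_s_d (h : IsOddDividedDiff a x s d) {i j : ℕ} (hi : 1 ≤ i) (hia : i + 1 ≤ a)
    (hj : 1 ≤ j) (hja : j + 1 ≤ a) (hij : i + 1 = j ∨ j + 1 = i) (f : R) :
    s i (s j (d i f)) = d j (s i (s j f)) := by
  induction f using h.induction with
  | one => simp [h.d_one i hi hia, h.d_one j hj hja]
  | var m hm hma =>
    obtain ⟨e, h1, h2⟩ := h.s_x_eq_neg hj hja hm hma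
    obtain ⟨e', h1', h2'⟩ := h.s_x_eq_neg hi hia h1 h2
    rw [h.s_d_x j hi hia hm hma, h.s_d_x i hi hia hm hma, e, map_neg, e', neg_neg,
      h.d_apply i m hi hia hm hma, h.d_apply j _ hj hja h1' h2']
    simp only [Equiv.swap_apply_def]
    grind
  | neg f hf => simp [hf]
  | add f g hf hg => simp [hf, hg]
  | mul f g hf hg =>
    simp only [h.d_mul i hi hia, h.d_mul j hj hja, map_add, map_mul, hf, hg,
      h.s_braid hi hia hj hja hij]

theorem s_d_d_add (h : IsOddDividedDiff a x s d) {i j : ℕ} (hi : 1 ≤ i) (hia : i + 1 ≤ a)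
    (hj : 1 ≤ j) (hja : j + 1 ≤ a) (hij : i + 1 = j ∨ j + 1 = i) (f : R) :
    s i (d j (d i f)) + d i (d j (s i f)) = d j (s i (d j f)) := by
  induction f using h.induction with
  | one => simp [h.d_one i hi hia, h.d_one j hj hja]
  | var m hm hma =>
    obtain ⟨e, h1, h2⟩ := h.s_x_eq_neg hi hia hm hma
    rw [h.d_d_x hj hja hi hia hm hma, e, map_neg, map_neg, h.d_d_x hi hia hj hja h1 h2,
      h.s_d_x i hj hja hm hma, h.d_d_x hj hja hj hja hm hma]
    simp
  | neg f hf => simp [← hf, add_comm]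
  | add f g hf hg => simp only [map_add, ← hf, ← hg]; abel
  | mul f g hf hg =>
    simp only [h.d_mul i hi hia, h.d_mul j hj hja, map_add, map_mul, ← hf, ← hg,
      h.s_s_d hi hia hj hja hij, ← h.s_s_d hj hja hi hia hij.symm,
      h.d_s_anticomm hi hia hi hia (Or.inl rfl), ← h.s_braid hi hia hj hja hij]
    noncomm_ring

theorem d_braid (h : IsOddDividedDiff a x s d) {i j : ℕ} (hi : 1 ≤ i) (hia : i + 1 ≤ a)
    (hj : 1 ≤ j) (hja : j + 1 ≤ a) (hij : i + 1 = j ∨ j + 1 = i) (f : R) :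
    d i (d j (d i f)) = d j (d i (d j f)) := by
  induction f using h.induction with
  | one => simp [h.d_one i hi hia, h.d_one j hj hja]
  | var m hm hma => simp [h.d_d_x hi hia hj hja hm hma, h.d_d_x hj hja hi hia hm hma]
  | neg f hf => simp [hf]
  | add f g hf hg => simp [hf, hg]
  | mul f g hf hg =>
    simp only [h.d_mul i hi hia, h.d_mul j hj hja, map_add, hf, hg, h.d_d_self hi hia,
      h.d_d_self hj hja, h.s_s_d hi hia hj hja hij, h.s_s_d hj hja hi hia hij.symm,
      ← h.s_d_d_add hi hia hj hja hij f, ← h.s_d_d_add hj hja hi hia hij.symm f,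
      h.s_braid hi hia hj hja hij]
    noncomm_ring

/-- The subring of elements killed by `d i` for all `1 ≤ i < min k a`. -/
def kerSubring (h : IsOddDividedDiff a x s d) (k : ℕ) : Subring R where
  carrier := {f | ∀ i, 1 ≤ i → i + 1 ≤ a → i < k → d i f = 0}
  mul_mem' hf hg i hi hia hik := by
    rw [h.d_mul i hi hia, hf i hi hia hik, hg i hi hia hik, zero_mul, mul_zero, add_zero]
  one_mem' i hi hia _ := h.d_one i hi hia
  add_mem' hf hg i hi hia hik := by rw [map_add, hf i hi hia hik, hg i hi hia hik, add_zero]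
  zero_mem' i _ _ _ := map_zero _
  neg_mem' hf i hi hia hik := by rw [map_neg, hf i hi hia hik, neg_zero]

theorem kerSubring_succ_le (h : IsOddDividedDiff a x s d) (k : ℕ) :
    h.kerSubring (k + 1) ≤ h.kerSubring k :=
  fun _ hf i hi hia hik => hf i hi hia (by omega)

theorem x_succ_mem_kerSubring (h : IsOddDividedDiff a x s d) {k : ℕ} (hk : k + 1 ≤ a) :
    x (k + 1) ∈ h.kerSubring k := fun i hi hia hik => by
  rw [h.d_apply i (k + 1) hi hia (by omega) hk, if_neg (by omega)]

/-- The composite `d (k - r + 1) ∘ ⋯ ∘ d (k - 1) ∘ d k` of length `r`. -/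
def descent (d : ℕ → R →+ R) (k : ℕ) : ℕ → R →+ R
  | 0 => AddMonoidHom.id R
  | r + 1 => (d (k - r)).comp (descent d k r)

@[simp]
theorem descent_zero_apply (d : ℕ → R →+ R) (k : ℕ) (f : R) : descent d k 0 f = f := rfl

theorem descent_succ_apply (d : ℕ → R →+ R) (k r : ℕ) (f : R) :
    descent d k (r + 1) f = d (k - r) (descent d k r f) := rfl

theorem d_descent (h : IsOddDividedDiff a x s d) {k : ℕ} (hk : k + 1 ≤ a) {f : R}
    (hf : f ∈ h.kerSubring k) (r : ℕ) (hr : r ≤ k) (i : ℕ) (hi : 1 ≤ i) (hik : i ≤ k)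
    (hir : i ≠ k - r) : d i (descent d k r f) = 0 := by
  induction r using Nat.strong_induction_on generalizing i with
  | _ r ih =>
  rcases r with _ | r
  · exact hf i hi (by omega) (by omega)
  rw [descent_succ_apply]
  rcases eq_or_ne i (k - r) with rfl | hi1
  · exact h.d_d_self hi (by omega) _
  by_cases hadj : i = k - r + 1
  · obtain ⟨r, rfl⟩ : ∃ q, r = q + 1 := ⟨r - 1, by omega⟩
    have e : k - r = i := by omega
    rw [descent_succ_apply, e, h.d_braid hi (by omega) (by omega) (by omega) (by omega),
      ih r (by omega) (by omega) _ (by omega) (by omega) (by omega), map_zero, map_zero]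
  · rw [h.d_anticomm hi (by omega) (by omega) (by omega) (by omega),
      ih r (by omega) (by omega) i hi hik hi1, map_zero, neg_zero]

theorem descent_self_mem (h : IsOddDividedDiff a x s d) {k : ℕ} (hk : k + 1 ≤ a) {f : R}
    (hf : f ∈ h.kerSubring k) : descent d k k f ∈ h.kerSubring (k + 1) :=
  fun i hi _ hik => h.d_descent hk hf k le_rfl i hi (by omega) (by omega)

theorem descent_mul (h : IsOddDividedDiff a x s d) {k : ℕ} (hk : k + 1 ≤ a) {g : R}
    (hg : g ∈ h.kerSubring (k + 1)) (f : R) (r : ℕ) (hr : r ≤ k) :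
    descent d k r (f * g) = descent d k r f * g := by
  induction r with
  | zero => rfl
  | succ r ih =>
    rw [descent_succ_apply, descent_succ_apply, ih (by omega),
      h.d_mul _ (by omega) (by omega), hg _ (by omega) (by omega) (by omega), mul_zero, add_zero]

theorem descent_succ_one (h : IsOddDividedDiff a x s d) {k : ℕ} (hk : k + 1 ≤ a) (r : ℕ)
    (hr : r + 1 ≤ k) : descent d k (r + 1) 1 = 0 := by
  induction r with
  | zero => exact h.d_one _ (by omega) (by omega)
  | succ r ih => rw [descent_succ_apply, ih (by omega), map_zero]

theorem descent_x_mul (h : IsOddDividedDiff a x s d) {k : ℕ} (hk : k + 1 ≤ a) {f : R}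
    (hf : f ∈ h.kerSubring k) (r : ℕ) (hr : r + 1 ≤ k) :
    descent d k (r + 1) (x (k + 1) * f) =
      (-1) ^ (r + 1) * (x (k - r) * descent d k (r + 1) f) + (-1) ^ r * descent d k r f := by
  have d_sign_mul : ∀ (m i : ℕ) (g : R), d i ((-1) ^ m * g) = (-1) ^ m * d i g := by
    intro m i g
    rcases neg_one_pow_eq_or R m with e | e <;> simp [e]
  have step : ∀ q, q + 1 ≤ k → ∀ g : R,
      d (k - q) (x (k - q + 1) * g) = g - x (k - q) * d (k - q) g := fun q hq g => by
    rw [h.d_mul _ (by omega) (by omega), h.d_apply _ _ (by omega) (by omega) (by omega) (by omega),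
      if_pos (Or.inr rfl), h.s_apply _ _ (by omega) (by omega) (by omega) (by omega),
      if_neg (by omega), if_pos rfl]
    noncomm_ring
  induction r with
  | zero =>
    have := step 0 hr f
    simp only [Nat.sub_zero] at this
    simp [descent_succ_apply, this, sub_eq_neg_add]
  | succ r ih =>
    have e : k - r = k - (r + 1) + 1 := by omega
    rw [descent_succ_apply, ih (by omega), map_add, d_sign_mul, d_sign_mul, e, step _ hr,
      h.d_descent hk hf r (by omega) _ (by omega) (by omega) (by omega),
      descent_succ_apply d k (r + 1)]
    noncomm_ring

theorem eq_zero_of_descent (h : IsOddDividedDiff a x s d) {k : ℕ} (hk : k + 1 ≤ a) {f : R}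
    (hf : f ∈ h.kerSubring k) (h0 : ∀ m ≤ k, descent d k k (x (k + 1) ^ m * f) = 0) : f = 0 := by
  have key : ∀ q r, r + q = k → ∀ m ≤ r, descent d k r (x (k + 1) ^ m * f) = 0 := by
    intro q
    induction q with
    | zero => rintro r rfl; exact h0
    | succ q ih =>
      intro r hr m hm
      have := h.descent_x_mul hk
        (mul_mem (pow_mem (h.x_succ_mem_kerSubring hk) m) hf) r (by omega)
      rw [← mul_assoc, ← pow_succ', ih (r + 1) (by omega) _ (by omega),
        ih (r + 1) (by omega) _ (by omega), mul_zero, mul_zero, zero_add] at this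
      rcases neg_one_pow_eq_or R r with e | e <;> simpa [e] using this.symm
  simpa using key k 0 (by omega) 0 le_rfl

theorem descent_x_pow (h : IsOddDividedDiff a x s d) {k : ℕ} (hk : k + 1 ≤ a) (m : ℕ) :
    ∀ r ≤ k, (m < r → descent d k r (x (k + 1) ^ m) = 0) ∧
      (m = r → ∃ n : ℕ, descent d k r (x (k + 1) ^ m) = (-1) ^ n) := by
  induction m with
  | zero =>
    refine fun r hr => ⟨fun hmr => ?_, ?_⟩
    · obtain ⟨r, rfl⟩ : ∃ q, r = q + 1 := ⟨r - 1, by omega⟩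
      rw [pow_zero, h.descent_succ_one hk r hr]
    · rintro rfl
      exact ⟨0, by simp⟩
  | succ m ih =>
    intro r hr
    rcases r with _ | r
    · simp
    have e := h.descent_x_mul hk (pow_mem (h.x_succ_mem_kerSubring hk) m) r hr
    rw [← pow_succ'] at e
    refine ⟨fun hmr => ?_, fun hmr => ?_⟩
    · rw [e, (ih (r + 1) hr).1 (by omega), (ih r (by omega)).1 (by omega)]
      simp
    · obtain ⟨n, hn⟩ := (ih r (by omega)).2 (by omega)
      exact ⟨r + n, by rw [e, (ih (r + 1) hr).1 (by omega), hn, mul_zero,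
        mul_zero, zero_add, pow_add]⟩

end IsOddDividedDiff

/-- Dual bases for a ring `A` over its subring `B`: the elements `b i` form a basis of the right
`B`-module `A`, with coordinate functionals the restrictions of the operators `φ i ∈ S`. -/
structure IsDualBasis {R ι : Type*} [Ring R] [Fintype ι] [DecidableEq ι]
    (S : Subring (Module.End ℤ R)) (A B : Subring R) (b : ι → R) (φ : ι → Module.End ℤ R) :
    Prop where
  mem : ∀ i, φ i ∈ S
  apply_mem : ∀ i, ∀ f ∈ A, φ i f ∈ B
  apply_basis_mul : ∀ i j, ∀ g ∈ B, φ i (b j * g) = if i = j then g else 0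
  basis_mem : ∀ i, b i ∈ A
  sum_eq : ∀ f ∈ A, ∑ i, b i * φ i f = f

namespace IsDualBasis

variable {R ι κ : Type*} [Ring R] [Fintype ι] [DecidableEq ι] [Fintype κ] [DecidableEq κ]
  {S : Subring (Module.End ℤ R)} {A B C : Subring R} {b : ι → R} {φ : ι → Module.End ℤ R}
  {c : κ → R} {ψ : κ → Module.End ℤ R}

theorem reindex (h : IsDualBasis S A B b φ) (e : κ ≃ ι) :
    IsDualBasis S A B (b ∘ e) (φ ∘ e) where
  mem i := h.mem _
  apply_mem i := h.apply_mem _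
  apply_basis_mul i j g hg := by simp [h.apply_basis_mul _ _ g hg]
  basis_mem i := h.basis_mem _
  sum_eq f hf := (e.sum_comp fun i => b i * φ i f).trans (h.sum_eq f hf)

theorem comp (h : IsDualBasis S A B b φ) (h' : IsDualBasis S B C c ψ) (hBA : B ≤ A)
    (hCB : C ≤ B) :
    IsDualBasis S A C (fun p : ι × κ => b p.1 * c p.2) (fun p => ψ p.2 * φ p.1) where
  mem p := mul_mem (h'.mem _) (h.mem _)
  apply_mem p f hf := h'.apply_mem _ _ (h.apply_mem _ f hf)
  apply_basis_mul p q g hg := by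
    rw [Module.End.mul_apply, mul_assoc,
      h.apply_basis_mul _ _ _ (mul_mem (h'.basis_mem _) (hCB hg))]
    split_ifs with h1 h2 h2
    · rw [h'.apply_basis_mul _ _ g hg, if_pos (by rw [h2])]
    · rw [h'.apply_basis_mul _ _ g hg, if_neg fun h3 => h2 (Prod.ext h1 h3)]
    · exact absurd (by rw [h2]) h1
    · exact map_zero _
  basis_mem p := mul_mem (h.basis_mem _) (hBA (h'.basis_mem _))
  sum_eq f hf := by
    rw [Fintype.sum_prod_type]
    conv_rhs => rw [← h.sum_eq f hf]
    refine Finset.sum_congr rfl fun i _ => ?_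
    simp only [Module.End.mul_apply, mul_assoc, ← Finset.mul_sum]
    rw [h'.sum_eq _ (h.apply_mem i f hf)]

theorem apply_eq_sum (h : IsDualBasis S ⊤ B b φ) {T : Module.End ℤ R}
    (hT : ∀ f, ∀ g ∈ B, T (f * g) = T f * g) (f : R) : T f = ∑ j, T (b j) * φ j f := by
  conv_lhs => rw [← h.sum_eq f trivial, map_sum]
  exact Finset.sum_congr rfl fun j _ => hT _ _ (h.apply_mem j f trivial)

theorem mem_of_map_mul (h : IsDualBasis S ⊤ B b φ) (hS : ∀ f, LinearMap.mulLeft ℤ f ∈ S)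
    {T : Module.End ℤ R} (hT : ∀ f, ∀ g ∈ B, T (f * g) = T f * g) : T ∈ S := by
  have e : T = ∑ j, LinearMap.mulLeft ℤ (T (b j)) * φ j := by
    ext f
    rw [h.apply_eq_sum hT]
    simp
  rw [e]
  exact sum_mem fun j _ => mul_mem (hS _) (h.mem j)

/-- The matrix of a `B`-linear operator in the basis `b`. -/
def toMatrix (h : IsDualBasis S ⊤ B b φ) (hT : ∀ T ∈ S, ∀ f, ∀ g ∈ B, T (f * g) = T f * g) :
    S →+* Matrix ι ι B where
  toFun T := Matrix.of fun i j => ⟨φ i ((T : Module.End ℤ R) (b j)), h.apply_mem i _ trivial⟩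
  map_one' := by
    ext i j
    have := h.apply_basis_mul i j 1 (one_mem B)
    rw [mul_one] at this
    simp [this, Matrix.one_apply, apply_ite (Subtype.val : B → R)]
  map_mul' T U := by
    ext i j
    have := h.apply_eq_sum (fun f g hg => hT _ (mul_mem (h.mem i) T.2) f g hg)
      ((U : Module.End ℤ R) (b j))
    simpa [Matrix.mul_apply] using this
  map_zero' := by ext i j; simp
  map_add' T U := by ext i j; simp

theorem toMatrix_bijective (h : IsDualBasis S ⊤ B b φ)
    (hT : ∀ T ∈ S, ∀ f, ∀ g ∈ B, T (f * g) = T f * g) (hS : ∀ f, LinearMap.mulLeft ℤ f ∈ S) :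
    Function.Bijective (h.toMatrix hT) := by
  constructor
  · rw [injective_iff_map_eq_zero]
    rintro ⟨T, hTS⟩ h0
    have hb : ∀ j, T (b j) = 0 := fun j => by
      rw [← h.sum_eq (T (b j)) trivial]
      refine Finset.sum_eq_zero fun i _ => ?_
      have : φ i (T (b j)) = 0 := congrArg (fun M : Matrix ι ι B => (M i j : R)) h0
      rw [this, mul_zero]
    ext f
    change T f = 0
    rw [h.apply_eq_sum (hT T hTS)]
    simp [hb]
  · intro M
    refine ⟨⟨∑ i, ∑ j, LinearMap.mulLeft ℤ (b i * M i j) * φ j,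
      sum_mem fun i _ => sum_mem fun j _ => mul_mem (hS _) (h.mem j)⟩, ?_⟩
    have hb : ∀ i j, φ i (b j) = if i = j then 1 else 0 := fun i j => by
      simpa using h.apply_basis_mul i j 1 (one_mem B)
    ext i j
    simp [toMatrix, hb, h.apply_basis_mul _ _ _ (M _ _).2]

end IsDualBasis

section Frobenius

variable {R : Type*} [Ring R] {S : Subring (Module.End ℤ R)} {A B : Subring R}
  {t : Module.End ℤ R} {z : R} {k : ℕ}

/-- The remainder after removing the components of an element along `z ^ k, …, z ^ (k - m + 1)`,
with respect to a trace form `t`. -/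
def remainder (t : Module.End ℤ R) (z : R) (k : ℕ) : ℕ → Module.End ℤ R
  | 0 => 1
  | m + 1 => remainder t z k m -
      LinearMap.mulLeft ℤ (z ^ (k - m)) * (LinearMap.mulLeft ℤ (t (z ^ k)) * t *
        LinearMap.mulLeft ℤ (z ^ m) * remainder t z k m)

theorem remainder_succ_apply (t : Module.End ℤ R) (z : R) (k m : ℕ) (f : R) :
    remainder t z k (m + 1) f = remainder t z k m f -
      z ^ (k - m) * (t (z ^ k) * t (z ^ m * remainder t z k m f)) :=
  rfl

/-- A `B`-linear trace `t : A → B` with `t (z ^ m) = 0` for `m < k` and `t (z ^ k) = ±1`, for which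
the powers of `z` separate the points of `A`, yields the basis `z ^ k, …, z, 1` of `A` over `B`. -/
theorem isDualBasis_of_trace (hS : ∀ f, LinearMap.mulLeft ℤ f ∈ S) (hBA : B ≤ A) (hz : z ∈ A)
    (htS : t ∈ S) (ht : ∀ f ∈ A, t f ∈ B) (htB : ∀ f, ∀ g ∈ B, t (f * g) = t f * g)
    (hlt : ∀ m < k, t (z ^ m) = 0) (hk : t (z ^ k) * t (z ^ k) = 1)
    (hsep : ∀ f ∈ A, (∀ m ≤ k, t (z ^ m * f) = 0) → f = 0) :
    IsDualBasis S A B (fun m : Fin (k + 1) => z ^ (k - (m : ℕ)))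
      (fun m => LinearMap.mulLeft ℤ (t (z ^ k)) * t * LinearMap.mulLeft ℤ (z ^ (m : ℕ)) *
        remainder t z k m) := by
  have hu : t (z ^ k) ∈ B := ht _ (pow_mem hz k)
  have hEA : ∀ m, ∀ f ∈ A, remainder t z k m f ∈ A := fun m f hf => by
    induction m with
    | zero => exact hf
    | succ m ih =>
      exact sub_mem ih (mul_mem (pow_mem hz _)
        (hBA (mul_mem hu (ht _ (mul_mem (pow_mem hz _) ih)))))
  have hES : ∀ m, remainder t z k m ∈ S := fun m => by
    induction m with
    | zero => exact one_mem S
    | succ m ih =>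
      exact sub_mem ih (mul_mem (hS _) (mul_mem (mul_mem (mul_mem (hS _) htS) (hS _)) ih))
  have hle : ∀ n ≤ k, ∀ g ∈ B, ∀ m ≤ n, remainder t z k m (z ^ (k - n) * g) = z ^ (k - n) * g := by
    intro n hn g hg m hm
    induction m with
    | zero => rfl
    | succ m ih =>
      rw [remainder_succ_apply, ih (by omega), ← mul_assoc (z ^ m), ← pow_add, htB _ _ hg,
        hlt (m + (k - n)) (by omega), zero_mul, mul_zero, mul_zero, sub_zero]
  have hgt : ∀ n ≤ k, ∀ g ∈ B, ∀ m, remainder t z k (n + 1 + m) (z ^ (k - n) * g) = 0 := by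
    intro n hn g hg m
    induction m with
    | zero =>
      rw [add_zero, remainder_succ_apply, hle n hn g hg n le_rfl, ← mul_assoc (z ^ n), ← pow_add,
        htB _ _ hg, Nat.add_sub_cancel' hn, ← mul_assoc (t _), hk, one_mul, sub_self]
    | succ m ih =>
      rw [← add_assoc, remainder_succ_apply, ih]
      simp
  refine ⟨fun m => mul_mem (mul_mem (mul_mem (hS _) htS) (hS _)) (hES m),
    fun m f hf => mul_mem hu (ht _ (mul_mem (pow_mem hz _) (hEA m f hf))), ?_,
    fun m => pow_mem hz _, ?_⟩
  · intro m n g hg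
    change t (z ^ k) * t (z ^ (m : ℕ) * remainder t z k m (z ^ (k - (n : ℕ)) * g)) = _
    rcases lt_trichotomy m n with hmn | rfl | hmn
    · rw [hle n (by omega) g hg m hmn.le, ← mul_assoc (z ^ (m : ℕ)), ← pow_add, htB _ _ hg,
        hlt (m + (k - n)) (by omega), zero_mul, mul_zero, if_neg hmn.ne]
    · rw [hle m (by omega) g hg m le_rfl, ← mul_assoc (z ^ (m : ℕ)), ← pow_add, htB _ _ hg,
        Nat.add_sub_cancel' (by omega), ← mul_assoc, hk, one_mul, if_pos rfl]
    · obtain ⟨q, hq⟩ : ∃ q, (m : ℕ) = n + 1 + q := ⟨m - (n + 1), by omega⟩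
      rw [hq, hgt n (by omega) g hg q, if_neg hmn.ne']
      simp
  · intro f hf
    have hsum : ∀ q, f = remainder t z k q f + ∑ m ∈ Finset.range q,
        z ^ (k - m) * (t (z ^ k) * t (z ^ m * remainder t z k m f)) := fun q => by
      induction q with
      | zero => simp [remainder]
      | succ q ih =>
        rw [Finset.sum_range_succ, remainder_succ_apply]
        conv_lhs => rw [ih]
        abel
    have h0 : remainder t z k (k + 1) f = 0 := by
      refine hsep _ (hEA _ f hf) fun m hm => ?_
      have key : ∀ q ≤ k + 1, ∀ m < q, t (z ^ m * remainder t z k q f) = 0 := by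
        intro q hq
        induction q with
        | zero => intro m hm; omega
        | succ q ih =>
          intro m hm
          have hy : t (z ^ k) * t (z ^ q * remainder t z k q f) ∈ B :=
            mul_mem hu (ht _ (mul_mem (pow_mem hz _) (hEA _ f hf)))
          rw [remainder_succ_apply, mul_sub, map_sub, ← mul_assoc (z ^ m), ← pow_add, htB _ _ hy]
          rcases (Nat.lt_succ_iff.1 hm).lt_or_eq with hmq | rfl
          · rw [ih (by omega) m hmq, hlt (m + (k - q)) (by omega), zero_mul, sub_zero]
          · rw [Nat.add_sub_cancel' (by omega), ← mul_assoc, hk, one_mul, sub_self]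
      exact key _ le_rfl m (by omega)
    conv_rhs => rw [hsum (k + 1), h0, zero_add, Finset.sum_range]
    rfl

end Frobenius

namespace IsOddDividedDiff

variable {R : Type*} [Ring R] {a : ℕ} {x : ℕ → R} {s : ℕ → R →+* R} {d : ℕ → R →+ R}
  {S : Subring (Module.End ℤ R)}

theorem descent_mem (hd : ∀ i, 1 ≤ i → i + 1 ≤ a → (d i).toIntLinearMap ∈ S) {k : ℕ}
    (hk : k + 1 ≤ a) (r : ℕ) (hr : r ≤ k) : (descent d k r).toIntLinearMap ∈ S := by
  induction r with
  | zero => exact one_mem S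
  | succ r ih => exact mul_mem (hd _ (by omega) (by omega)) (ih (by omega))

theorem exists_isDualBasis_succ (h : IsOddDividedDiff a x s d)
    (hS : ∀ f, LinearMap.mulLeft ℤ f ∈ S)
    (hd : ∀ i, 1 ≤ i → i + 1 ≤ a → (d i).toIntLinearMap ∈ S) {k : ℕ} (hk : k + 1 ≤ a) :
    ∃ (b : Fin (k + 1) → R) (φ : Fin (k + 1) → Module.End ℤ R),
      IsDualBasis S (h.kerSubring k) (h.kerSubring (k + 1)) b φ := by
  refine ⟨_, _, isDualBasis_of_trace (t := (descent d k k).toIntLinearMap) hS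
    (h.kerSubring_succ_le k) (h.x_succ_mem_kerSubring hk) (descent_mem hd hk k le_rfl)
    (fun f hf => h.descent_self_mem hk hf) (fun f g hg => h.descent_mul hk hg f k le_rfl)
    (fun m hm => (h.descent_x_pow hk m k le_rfl).1 hm) ?_
    (fun f hf => h.eq_zero_of_descent hk hf)⟩
  obtain ⟨n, hn⟩ := (h.descent_x_pow hk k k le_rfl).2 rfl
  change descent d k k _ * descent d k k _ = 1
  rw [hn, ← pow_add, Even.neg_one_pow ⟨n, rfl⟩]

theorem exists_isDualBasis (h : IsOddDividedDiff a x s d) (hS : ∀ f, LinearMap.mulLeft ℤ f ∈ S)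
    (hd : ∀ i, 1 ≤ i → i + 1 ≤ a → (d i).toIntLinearMap ∈ S) (k : ℕ) (hk : k ≤ a) :
    ∃ (b : Fin k.factorial → R) (φ : Fin k.factorial → Module.End ℤ R),
      IsDualBasis S ⊤ (h.kerSubring k) b φ := by
  induction k with
  | zero =>
    refine ⟨fun _ => 1, fun _ => 1, fun _ => one_mem S, fun _ f _ i _ _ hi => by omega, ?_,
      fun _ => trivial, fun f _ => ?_⟩
    · intro i j g _
      rw [if_pos (show i = j from Subsingleton.elim (α := Fin 1) i j), one_mul]
      rfl
    · exact (Fin.sum_univ_one _).trans (one_mul f)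
  | succ k ih =>
    obtain ⟨b, φ, hb⟩ := ih (by omega)
    obtain ⟨c, ψ, hc⟩ := h.exists_isDualBasis_succ hS hd hk
    exact ⟨_, _, (hb.comp hc le_top (h.kerSubring_succ_le k)).reindex
      ((finCongr (by rw [Nat.factorial_succ, mul_comm])).trans finProdFinEquiv.symm)⟩

end IsOddDividedDiff

theorem closure_image_xv (a : ℕ) : Subring.closure (xv a '' Set.Icc 1 a) = ⊤ := by
  refine eq_top_iff.2 fun f _ => ?_
  obtain ⟨p, rfl⟩ := RingQuot.mkRingHom_surjective (OddRel a) f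
  induction p using FreeAlgebra.induction with
  | grade0 r => simp
  | grade1 i =>
    exact Subring.subset_closure ⟨i + 1, ⟨by omega, i.2⟩, by simp [xv, OX]⟩
  | mul p q hp hq => rw [map_mul]; exact mul_mem (hp trivial) (hq trivial)
  | add p q hp hq => rw [map_add]; exact add_mem (hp trivial) (hq trivial)

theorem mulLeft_mem_closure_onhGens {a : ℕ} (d : ℕ → OPol a →+ OPol a) (f : OPol a) :
    LinearMap.mulLeft ℤ f ∈ Subring.closure (onhGens a d) := by
  have hf : f ∈ Subring.closure (xv a '' Set.Icc 1 a) := closure_image_xv a ▸ trivial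
  induction hf using Subring.closure_induction with
  | mem y hy =>
    obtain ⟨j, ⟨hj, hja⟩, rfl⟩ := hy
    exact Subring.subset_closure (Or.inl ⟨⟨j - 1, by omega⟩, by rw [xv, dif_pos ⟨hj, hja⟩]; rfl⟩)
  | zero => simp
  | one => rw [LinearMap.mulLeft_one]; exact one_mem _
  | add f g _ _ hf hg =>
    have : LinearMap.mulLeft ℤ (f + g) = LinearMap.mulLeft ℤ f + LinearMap.mulLeft ℤ g := by
      ext y; simp [add_mul]
    exact this ▸ add_mem hf hg
  | neg f _ hf =>
    have : LinearMap.mulLeft ℤ (-f) = -LinearMap.mulLeft ℤ f := LinearMap.ext (neg_mul f)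
    exact this ▸ neg_mem hf
  | mul f g _ _ hf hg =>
    rw [LinearMap.mulLeft_mul]
    exact mul_mem hf hg

/-- every element of ONH_a is right OΛ_a-linear, ONH_a is exactly the ring of
right OΛ_a-linear endomorphisms of OPol_a, and ONH_a is isomorphic to the a!×a! matrix
ring over OΛ_a. -/
theorem odd_nilHecke_is_matrix_ring (a : ℕ)
    (s : ℕ → OPol a →+* OPol a)
    (hs : ∀ i j : ℕ, 1 ≤ i → i + 1 ≤ a → 1 ≤ j → j ≤ a →
      s i (xv a j) =
        if j = i then -xv a (i + 1) else if j = i + 1 then -xv a i else -xv a j)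
    (d : ℕ → OPol a →+ OPol a)
    (hd1 : ∀ i : ℕ, 1 ≤ i → i + 1 ≤ a → d i 1 = 0)
    (hdx : ∀ i j : ℕ, 1 ≤ i → i + 1 ≤ a → 1 ≤ j → j ≤ a →
      d i (xv a j) = if j = i ∨ j = i + 1 then 1 else 0)
    (hdL : ∀ i : ℕ, 1 ≤ i → i + 1 ≤ a → ∀ f g : OPol a,
      d i (f * g) = d i f * g + s i f * d i g) :
    (∀ T ∈ Subring.closure (onhGens a d), ∀ f g : OPol a,
      (∀ i : ℕ, 1 ≤ i → i + 1 ≤ a → d i g = 0) → T (f * g) = T f * g) ∧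
    (∀ T : Module.End ℤ (OPol a),
      (∀ f g : OPol a, (∀ i : ℕ, 1 ≤ i → i + 1 ≤ a → d i g = 0) → T (f * g) = T f * g) →
      T ∈ Subring.closure (onhGens a d)) ∧
    (∃ OL : Subring (OPol a),
      (OL : Set (OPol a)) = {f : OPol a | ∀ i : ℕ, 1 ≤ i → i + 1 ≤ a → d i f = 0} ∧
      Nonempty (↥(Subring.closure (onhGens a d)) ≃+*
        Matrix (Fin (Nat.factorial a)) (Fin (Nat.factorial a)) ↥OL)) := by
  have h : IsOddDividedDiff a (xv a) s d := ⟨closure_image_xv a, hs, hd1, hdx, hdL⟩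
  have hOL : ∀ g, g ∈ h.kerSubring a ↔ ∀ i : ℕ, 1 ≤ i → i + 1 ≤ a → d i g = 0 := fun g =>
    ⟨fun hg i hi hia => hg i hi hia (by omega), fun hg i hi hia _ => hg i hi hia⟩
  have hT : ∀ T ∈ Subring.closure (onhGens a d), ∀ f, ∀ g ∈ h.kerSubring a,
      T (f * g) = T f * g := by
    intro T hT f g hg
    induction hT using Subring.closure_induction generalizing f with
    | mem T hT =>
      obtain ⟨i, rfl⟩ | ⟨i, hi, hia, rfl⟩ := hT
      · exact (mul_assoc _ f g).symm
      · change d i (f * g) = d i f * g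
        rw [hdL i hi hia, (hOL g).1 hg i hi hia, mul_zero, add_zero]
    | zero => exact (zero_mul g).symm
    | one => rfl
    | add T U _ _ ihT ihU => rw [LinearMap.add_apply, LinearMap.add_apply, ihT, ihU, add_mul]
    | neg T _ ihT => exact (congrArg Neg.neg (ihT f)).trans (neg_mul (T f) g).symm
    | mul T U _ _ ihT ihU => rw [Module.End.mul_apply, Module.End.mul_apply, ihU, ihT]
  have hS := mulLeft_mem_closure_onhGens d
  obtain ⟨b, φ, hb⟩ := h.exists_isDualBasis hS
    (fun i hi hia => Subring.subset_closure (Or.inr ⟨i, hi, hia, rfl⟩)) a le_rfl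
  exact ⟨fun T hTS f g hg => hT T hTS f g ((hOL g).2 hg),
    fun T hTg => hb.mem_of_map_mul hS fun f g hg => hTg f g ((hOL g).1 hg),
    h.kerSubring a, Set.ext hOL,
    ⟨RingEquiv.ofBijective (hb.toMatrix hT) (hb.toMatrix_bijective hT hS)⟩⟩
end

section
/- Define the odd symmetrization operator S: OPol_a → OPol_a by S(f) = (−1)^{C(a,3)} · w_0( D_a(f·x^{δ_a}) ), where C(a,3) = a(a−1)(a−2)/6. Then S is a left OΛ_a-linear projection onto OΛ_a: the image of S is contained in OΛ_a, S(f) = f for every f ∈ OΛ_a (in particular S∘S = S and S is surjective onto OΛ_a), and S(f·g) = f·S(g) for every f ∈ OΛ_a and g ∈ OPol_a. -/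
open scoped BigOperators

namespace OPol

variable {a : ℕ}

theorem xv_of_le {i : ℕ} (h1 : 1 ≤ i) (h2 : i ≤ a) : xv a i = OX ⟨i - 1, by omega⟩ :=
  dif_pos ⟨h1, h2⟩

theorem OX_eq_xv (i : Fin a) : OX i = xv a (i + 1) := by
  rw [xv_of_le (by omega) (by omega)]
  rfl

theorem OX_anticomm {i j : Fin a} (h : i ≠ j) : OX i * OX j = -(OX j * OX i) := by
  have := RingQuot.mkRingHom_rel (OddRel.anticomm i j h)
  simpa [OX] using this

theorem xv_anticomm {i j : ℕ} (h : i ≠ j) : xv a i * xv a j = -(xv a j * xv a i) := by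
  unfold xv
  split_ifs with hi hj
  · exact OX_anticomm (by simp [Fin.ext_iff]; omega)
  all_goals simp

/-- Induction on odd polynomials by left multiplication with variables. -/
theorem induction {C : OPol a → Prop} (one : C 1) (add : ∀ f g, C f → C g → C (f + g))
    (neg : ∀ f, C f → C (-f)) (mul : ∀ j f, 1 ≤ j → j ≤ a → C f → C (xv a j * f))
    (f : OPol a) : C f := by
  have zero : C 0 := by simpa using add _ _ one (neg _ one)
  have key : ∀ p : FreeAlgebra ℤ (Fin a), ∀ g, C g → C (RingQuot.mkRingHom (OddRel a) p * g) := by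
    intro p
    induction p using FreeAlgebra.induction with
    | grade0 r =>
      intro g hg
      have hnat : ∀ n : ℕ, C ((n : OPol a) * g) := by
        intro n
        induction n with
        | zero => simpa using zero
        | succ n ih => simpa [add_mul] using add _ _ ih hg
      rw [eq_intCast (algebraMap ℤ (FreeAlgebra ℤ (Fin a))) r, map_intCast]
      obtain ⟨n, rfl | rfl⟩ := r.eq_nat_or_neg
      · simpa using hnat n
      · have h2 := neg _ (hnat n)
        rw [Int.cast_neg, Int.cast_natCast]
        exact (congrArg C (neg_mul (n : OPol a) g)).mpr h2
    | grade1 i =>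
      intro g hg
      have := mul (i + 1) g (by omega) (by omega) hg
      rwa [← OX_eq_xv] at this
    | mul p q hp hq =>
      intro g hg
      rw [map_mul, mul_assoc]
      exact hp _ (hq _ hg)
    | add p q hp hq =>
      intro g hg
      rw [map_add, add_mul]
      exact add _ _ (hp _ hg) (hq _ hg)
  obtain ⟨p, rfl⟩ := RingQuot.mkRingHom_surjective (OddRel a) f
  simpa using key p 1 one

theorem ringHom_ext {R : Type*} [Ring R] {A B : OPol a →+* R}
    (h : ∀ j, 1 ≤ j → j ≤ a → A (xv a j) = B (xv a j)) (f : OPol a) : A f = B f := by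
  induction f using OPol.induction with
  | one => rw [map_one, map_one]
  | add f g hf hg => rw [map_add, map_add, hf, hg]
  | neg f hf => rw [map_neg, map_neg, hf]
  | mul j f h1 h2 hf => rw [map_mul, map_mul, hf, h j h1 h2]

/-- The ring homomorphism out of `OPol a` given by pairwise anticommuting elements. -/
noncomputable def lift {R : Type*} [Ring R] (y : Fin a → R)
    (hy : ∀ i j, i ≠ j → y i * y j = -(y j * y i)) : OPol a →+* R :=
  RingQuot.lift ⟨(FreeAlgebra.lift ℤ y : FreeAlgebra ℤ (Fin a) →ₐ[ℤ] R).toRingHom, by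
    rintro _ _ ⟨i, j, h⟩
    simpa using hy i j h⟩

theorem lift_OX {R : Type*} [Ring R] (y : Fin a → R)
    (hy : ∀ i j, i ≠ j → y i * y j = -(y j * y i)) (i : Fin a) : lift y hy (OX i) = y i := by
  simp [lift, OX]

/-- The parity automorphism, negating every variable. -/
noncomputable def parity (a : ℕ) : OPol a →+* OPol a :=
  lift (fun i => -OX i) fun i j h =>
    (neg_mul_neg (OX i) (OX j)).trans
      ((OX_anticomm h).trans (congrArg Neg.neg (neg_mul_neg (OX j) (OX i)).symm))

theorem parity_OX (i : Fin a) : parity a (OX i) = -OX i := lift_OX _ _ i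

theorem parity_parity (f : OPol a) : parity a (parity a f) = f :=
  ringHom_ext (A := (parity a).comp (parity a)) (B := RingHom.id _)
    (fun j h1 h2 => by simp [xv_of_le h1 h2, parity_OX]) f

/-- The parity automorphism as an additive endomorphism. -/
noncomputable def parityEnd (a : ℕ) : AddMonoid.End (OPol a) := (parity a).toAddMonoidHom

theorem parityEnd_mul_self : parityEnd a * parityEnd a = 1 :=
  AddMonoidHom.ext parity_parity

theorem isUnit_parityEnd : IsUnit (parityEnd a) :=
  ⟨⟨_, _, parityEnd_mul_self, parityEnd_mul_self⟩, rfl⟩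

/-- Left multiplication as a ring homomorphism. -/
noncomputable def mulLeftHom (a : ℕ) : OPol a →+* AddMonoid.End (OPol a) :=
  Module.toAddMonoidEnd (OPol a) (OPol a)

end OPol

/-- Composite of ring endomorphisms along a word, leftmost letter acting last. -/
def ringWord {R : Type*} [Ring R] (s : ℕ → R →+* R) : List ℕ → (R →+* R)
  | [] => RingHom.id _
  | i :: l => (s i).comp (ringWord s l)

/-- Composite of additive endomorphisms along a word, leftmost letter acting last. -/
def addWord {R : Type*} [Ring R] (d : ℕ → R →+ R) : List ℕ → (R →+ R)
  | [] => AddMonoidHom.id _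
  | i :: l => (d i).comp (addWord d l)

/-- The word `k, k-1, …, 1`. -/
def descWord (k : ℕ) : List ℕ := (List.range k).reverse.map (· + 1)

/-- The common algebra of anticommuting variables `x 1, …, x a` with odd divided differences. -/
structure OddSystem {R : Type*} [Ring R] (a : ℕ) (x : ℕ → R) (s : ℕ → R →+* R)
    (d : ℕ → R →+ R) : Prop where
  anticomm : ∀ i j, i ≠ j → x i * x j = -(x j * x i)
  induct : ∀ C : R → Prop, C 1 → (∀ f g, C f → C g → C (f + g)) → (∀ f, C f → C (-f)) →
    (∀ j f, 1 ≤ j → j ≤ a → C f → C (x j * f)) → ∀ f, C f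
  s_x : ∀ i j : ℕ, 1 ≤ i → i + 1 ≤ a → 1 ≤ j → j ≤ a →
    s i (x j) = if j = i then -x (i + 1) else if j = i + 1 then -x i else -x j
  d_x : ∀ i j : ℕ, 1 ≤ i → i + 1 ≤ a → 1 ≤ j → j ≤ a →
    d i (x j) = if j = i ∨ j = i + 1 then 1 else 0
  leibniz : ∀ i : ℕ, 1 ≤ i → i + 1 ≤ a → ∀ f g, d i (f * g) = d i f * g + s i f * d i g

theorem descWord_succ (k : ℕ) : descWord (k + 1) = (k + 1) :: descWord k := by
  simp [descWord, List.range_succ]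

theorem mem_descWord {i k : ℕ} : i ∈ descWord k ↔ 1 ≤ i ∧ i ≤ k := by
  simp only [descWord, List.mem_map, List.mem_reverse, List.mem_range]
  constructor
  · rintro ⟨j, h, rfl⟩
    omega
  · rintro ⟨h1, h2⟩
    exact ⟨i - 1, by omega, by omega⟩

theorem DList_succ (m : ℕ) : DList (m + 1) = DList m ++ descWord m := by
  simp [DList, descWord, List.range_succ]

theorem mem_DList {i m : ℕ} (h : i ∈ DList m) : 1 ≤ i ∧ i + 1 ≤ m := by
  induction m with
  | zero => simp [DList] at h
  | succ m ih =>
    rw [DList_succ, List.mem_append, mem_descWord] at h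
    rcases h with h | h
    · have := ih h
      omega
    · omega

section words

variable {R : Type*} [Ring R]

theorem addWord_append (d : ℕ → R →+ R) (l l' : List ℕ) (f : R) :
    addWord d (l ++ l') f = addWord d l (addWord d l' f) := by
  induction l with
  | nil => rfl
  | cons i l ih => simp [addWord, ih]

theorem ringWord_append (s : ℕ → R →+* R) (l l' : List ℕ) (f : R) :
    ringWord s (l ++ l') f = ringWord s l (ringWord s l' f) := by
  induction l with
  | nil => rfl
  | cons i l ih => simp [ringWord, ih]

theorem addWord_desc_succ (d : ℕ → R →+ R) (k : ℕ) (f : R) :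
    addWord d (descWord (k + 1)) f = d (k + 1) (addWord d (descWord k) f) := by
  rw [descWord_succ]; rfl

theorem ringWord_desc_succ (s : ℕ → R →+* R) (k : ℕ) (f : R) :
    ringWord s (descWord (k + 1)) f = s (k + 1) (ringWord s (descWord k) f) := by
  rw [descWord_succ]; rfl

theorem addWord_DList_succ (d : ℕ → R →+ R) (m : ℕ) (f : R) :
    addWord d (DList (m + 1)) f = addWord d (DList m) (addWord d (descWord m) f) := by
  rw [DList_succ, addWord_append]

theorem ringWord_DList_succ (s : ℕ → R →+* R) (m : ℕ) (f : R) :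
    ringWord s (DList (m + 1)) f = ringWord s (DList m) (ringWord s (descWord m) f) := by
  rw [DList_succ, ringWord_append]

end words

namespace OddSystem

variable {R : Type*} [Ring R] {a : ℕ} {x : ℕ → R} {s : ℕ → R →+* R} {d : ℕ → R →+ R}

/-- Additive maps satisfying the same twisted Leibniz rule agree if they agree on variables. -/
theorem twisted_ext (S : OddSystem a x s d) {A B : R →+ R} (σ τ : R →+* R)
    (hA : ∀ f g, A (f * g) = A f * σ g + τ f * A g)
    (hB : ∀ f g, B (f * g) = B f * σ g + τ f * B g)
    (h : ∀ j, 1 ≤ j → j ≤ a → A (x j) = B (x j)) (f : R) : A f = B f := by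
  have hA1 : A 1 = 0 := by simpa using hA 1 1
  have hB1 : B 1 = 0 := by simpa using hB 1 1
  refine S.induct (fun f => A f = B f) ?_ ?_ ?_ ?_ f
  · rw [hA1, hB1]
  · intro f g hf hg
    rw [map_add, map_add, hf, hg]
  · intro f hf
    rw [map_neg, map_neg, hf]
  · intro j f h1 h2 hf
    rw [hA, hB, hf, h j h1 h2]

theorem ringHom_ext (S : OddSystem a x s d) {T : Type*} [Ring T] {A B : R →+* T}
    (h : ∀ j, 1 ≤ j → j ≤ a → A (x j) = B (x j)) (f : R) : A f = B f := by
  refine S.induct (fun f => A f = B f) ?_ ?_ ?_ ?_ f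
  · rw [map_one, map_one]
  · intro f g hf hg
    rw [map_add, map_add, hf, hg]
  · intro f hf
    rw [map_neg, map_neg, hf]
  · intro j f h1 h2 hf
    rw [map_mul, map_mul, hf, h j h1 h2]

theorem d_one (S : OddSystem a x s d) {i : ℕ} (h1 : 1 ≤ i) (h2 : i + 1 ≤ a) : d i 1 = 0 := by
  simpa using S.leibniz i h1 h2 1 1

theorem d_mul_right (S : OddSystem a x s d) {i : ℕ} (h1 : 1 ≤ i) (h2 : i + 1 ≤ a) {f g : R}
    (hg : d i g = 0) : d i (f * g) = d i f * g := by
  rw [S.leibniz i h1 h2, hg, mul_zero, add_zero]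

theorem s_s (S : OddSystem a x s d) {i : ℕ} (h1 : 1 ≤ i) (h2 : i + 1 ≤ a) (f : R) :
    s i (s i f) = f := by
  refine S.ringHom_ext (A := (s i).comp (s i)) (B := RingHom.id _) ?_ f
  intro j hj1 hj2
  simp only [RingHom.comp_apply, RingHom.id_apply]
  rw [S.s_x i j h1 h2 hj1 hj2]
  split_ifs with h h'
  · rw [map_neg, S.s_x i (i + 1) h1 h2 (by omega) h2]
    simp [h]
  · rw [map_neg, S.s_x i i h1 h2 (by omega) (by omega)]
    simp [h']
  · rw [map_neg, S.s_x i j h1 h2 hj1 hj2]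
    simp [h, h']

theorem s_comm (S : OddSystem a x s d) {i j : ℕ} (hi : 1 ≤ i) (hi' : i + 1 ≤ a) (hj : 1 ≤ j)
    (hj' : j + 1 ≤ a) (hij : i + 1 < j ∨ j + 1 < i) (f : R) :
    s i (s j f) = s j (s i f) := by
  refine S.ringHom_ext (A := (s i).comp (s j)) (B := (s j).comp (s i)) ?_ f
  intro k hk1 hk2
  have hs := S.s_x
  simp only [RingHom.comp_apply]
  by_cases h1 : k = i
  · subst h1
    rw [hs j k hj hj' hk1 hk2, if_neg (by omega), if_neg (by omega), hs k k hi hi' hk1 hk2,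
      if_pos rfl, map_neg, map_neg, hs k k hi hi' hk1 hk2, if_pos rfl,
      hs j (k + 1) hj hj' (by omega) (by omega), if_neg (by omega), if_neg (by omega)]
  by_cases h2 : k = i + 1
  · subst h2
    rw [hs j _ hj hj' hk1 hk2, if_neg (by omega), if_neg (by omega), hs i _ hi hi' hk1 hk2,
      if_neg (by omega), if_pos rfl, map_neg, map_neg, hs i _ hi hi' hk1 hk2, if_neg (by omega),
      if_pos rfl, hs j i hj hj' (by omega) (by omega), if_neg (by omega), if_neg (by omega)]
  rw [hs i k hi hi' hk1 hk2, if_neg h1, if_neg h2, hs j k hj hj' hk1 hk2, map_neg,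
    hs j k hj hj' hk1 hk2]
  split_ifs with h3 h4
  · rw [map_neg, hs i _ hi hi' (by omega) (by omega), if_neg (by omega), if_neg (by omega)]
  · rw [map_neg, hs i _ hi hi' (by omega) (by omega), if_neg (by omega), if_neg (by omega)]
  · rw [map_neg, hs i _ hi hi' (by omega) (by omega), if_neg (by omega), if_neg (by omega)]

theorem s_x_left (S : OddSystem a x s d) {i : ℕ} (h1 : 1 ≤ i) (h2 : i + 1 ≤ a) :
    s i (x i) = -x (i + 1) := by
  rw [S.s_x i i h1 h2 h1 (by omega), if_pos rfl]

theorem s_x_right (S : OddSystem a x s d) {i : ℕ} (h1 : 1 ≤ i) (h2 : i + 1 ≤ a) :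
    s i (x (i + 1)) = -x i := by
  rw [S.s_x i _ h1 h2 (by omega) h2, if_neg (by omega), if_pos rfl]

theorem s_x_of_ne (S : OddSystem a x s d) {i j : ℕ} (h1 : 1 ≤ i) (h2 : i + 1 ≤ a) (h3 : 1 ≤ j)
    (h4 : j ≤ a) (h5 : j ≠ i) (h6 : j ≠ i + 1) : s i (x j) = -x j := by
  rw [S.s_x i j h1 h2 h3 h4, if_neg h5, if_neg h6]

theorem d_x_left (S : OddSystem a x s d) {i : ℕ} (h1 : 1 ≤ i) (h2 : i + 1 ≤ a) :
    d i (x i) = 1 := by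
  rw [S.d_x i i h1 h2 h1 (by omega), if_pos (Or.inl rfl)]

theorem d_x_right (S : OddSystem a x s d) {i : ℕ} (h1 : 1 ≤ i) (h2 : i + 1 ≤ a) :
    d i (x (i + 1)) = 1 := by
  rw [S.d_x i _ h1 h2 (by omega) h2, if_pos (Or.inr rfl)]

theorem d_x_of_ne (S : OddSystem a x s d) {i j : ℕ} (h1 : 1 ≤ i) (h2 : i + 1 ≤ a) (h3 : 1 ≤ j)
    (h4 : j ≤ a) (h5 : j ≠ i) (h6 : j ≠ i + 1) : d i (x j) = 0 := by
  rw [S.d_x i j h1 h2 h3 h4, if_neg (by tauto)]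

theorem s_braid_succ (S : OddSystem a x s d) {i : ℕ} (h1 : 1 ≤ i) (h2 : i + 2 ≤ a) (f : R) :
    s i (s (i + 1) (s i f)) = s (i + 1) (s i (s (i + 1) f)) := by
  refine S.ringHom_ext (A := (s i).comp ((s (i + 1)).comp (s i)))
    (B := (s (i + 1)).comp ((s i).comp (s (i + 1)))) ?_ f
  intro k hk1 hk2
  have e1 := S.s_x_left h1 (by omega)
  have e2 := S.s_x_right h1 (by omega)
  have e3 := S.s_x_left (i := i + 1) (by omega) (by omega)
  have e4 := S.s_x_right (i := i + 1) (by omega) (by omega)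
  have e5 := S.s_x_of_ne (i := i) (j := i + 1 + 1) h1 (by omega) (by omega) (by omega) (by omega)
    (by omega)
  have e6 := S.s_x_of_ne (i := i + 1) (j := i) (by omega) (by omega) (by omega) (by omega)
    (by omega) (by omega)
  simp only [RingHom.comp_apply]
  by_cases h : k = i
  · subst h; simp only [map_neg, e1, e3, e5, e6]
  by_cases h' : k = i + 1
  · subst h'; simp only [map_neg, e1, e2, e3, e4, e5, e6]
  by_cases h'' : k = i + 1 + 1
  · subst h''; simp only [map_neg, e2, e4, e5, e6]
  have e7 := S.s_x_of_ne (i := i) (j := k) h1 (by omega) hk1 hk2 (by omega) (by omega)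
  have e8 := S.s_x_of_ne (i := i + 1) (j := k) (by omega) (by omega) hk1 hk2 (by omega) (by omega)
  simp only [map_neg, e7, e8]

/-- Two neighbouring indices of simple transpositions. -/
def Adj (a p q : ℕ) : Prop := 1 ≤ p ∧ 1 ≤ q ∧ p + 1 ≤ a ∧ q + 1 ≤ a ∧ (q = p + 1 ∨ p = q + 1)

theorem Adj.symm {p q : ℕ} (h : Adj a p q) : Adj a q p := by
  unfold Adj at *; omega

theorem s_braid (S : OddSystem a x s d) {p q : ℕ} (h : Adj a p q) (f : R) :
    s p (s q (s p f)) = s q (s p (s q f)) := by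
  obtain ⟨h1, h2, h3, h4, rfl | rfl⟩ := h
  · exact S.s_braid_succ h1 h4 f
  · exact (S.s_braid_succ h2 h3 f).symm

theorem d_s_self (S : OddSystem a x s d) {i : ℕ} (h1 : 1 ≤ i) (h2 : i + 1 ≤ a) (f : R) :
    d i (s i f) = -s i (d i f) := by
  refine S.twisted_ext (A := (d i).comp (s i).toAddMonoidHom)
    (B := -((s i).toAddMonoidHom.comp (d i))) (s i) (RingHom.id _) ?_ ?_ ?_ f
  · intro f g
    simp [S.leibniz i h1 h2, S.s_s h1 h2]
  · intro f g
    simp [S.leibniz i h1 h2, S.s_s h1 h2]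
    abel
  · intro j hj1 hj2
    by_cases h : j = i
    · subst h; simp [S.s_x_left h1 h2, S.d_x_left h1 h2, S.d_x_right h1 h2]
    by_cases h' : j = i + 1
    · subst h'; simp [S.s_x_right h1 h2, S.d_x_left h1 h2, S.d_x_right h1 h2]
    simp [S.s_x_of_ne h1 h2 hj1 hj2 h h', S.d_x_of_ne h1 h2 hj1 hj2 h h']

theorem d_d_self (S : OddSystem a x s d) {i : ℕ} (h1 : 1 ≤ i) (h2 : i + 1 ≤ a) (f : R) :
    d i (d i f) = 0 := by
  refine S.twisted_ext (A := (d i).comp (d i)) (B := 0) (RingHom.id _) (RingHom.id _) ?_ ?_ ?_ f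
  · intro f g
    simp [S.leibniz i h1 h2, S.s_s h1 h2, S.d_s_self h1 h2]
  · simp
  · intro j hj1 hj2
    simp only [AddMonoidHom.comp_apply, AddMonoidHom.zero_apply]
    rw [S.d_x i j h1 h2 hj1 hj2]
    split_ifs
    · exact S.d_one h1 h2
    · simp

theorem d_s_far (S : OddSystem a x s d) {i j : ℕ} (hi : 1 ≤ i) (hi' : i + 1 ≤ a) (hj : 1 ≤ j)
    (hj' : j + 1 ≤ a) (hij : i + 1 < j ∨ j + 1 < i) (f : R) :
    d i (s j f) = -s j (d i f) := by
  refine S.twisted_ext (A := (d i).comp (s j).toAddMonoidHom)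
    (B := -((s j).toAddMonoidHom.comp (d i))) (s j) ((s i).comp (s j)) ?_ ?_ ?_ f
  · intro f g
    simp [S.leibniz i hi hi']
  · intro f g
    simp [S.leibniz i hi hi', S.s_comm hi hi' hj hj' hij]
    abel
  · intro k hk1 hk2
    simp only [AddMonoidHom.comp_apply, AddMonoidHom.neg_apply, RingHom.toAddMonoidHom_eq_coe,
      AddMonoidHom.coe_coe]
    rw [S.s_x j k hj hj' hk1 hk2, S.d_x i k hi hi' hk1 hk2]
    by_cases h : k = i ∨ k = i + 1
    · rw [if_pos h, if_neg (by omega), if_neg (by omega), map_neg, S.d_x i k hi hi' hk1 hk2,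
        if_pos h, map_one]
    rw [if_neg h, map_zero, neg_zero]
    split_ifs <;> rw [map_neg, S.d_x i _ hi hi' (by omega) (by omega), if_neg (by omega), neg_zero]

theorem d_d_far (S : OddSystem a x s d) {i j : ℕ} (hi : 1 ≤ i) (hi' : i + 1 ≤ a) (hj : 1 ≤ j)
    (hj' : j + 1 ≤ a) (hij : i + 1 < j ∨ j + 1 < i) (f : R) :
    d i (d j f) = -d j (d i f) := by
  rw [← add_eq_zero_iff_eq_neg]
  refine S.twisted_ext (A := (d i).comp (d j) + (d j).comp (d i)) (B := 0)
    (RingHom.id _) ((s i).comp (s j)) ?_ ?_ ?_ f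
  · intro f g
    simp [S.leibniz i hi hi', S.leibniz j hj hj', S.d_s_far hi hi' hj hj' hij,
      S.d_s_far hj hj' hi hi' hij.symm, S.s_comm hj hj' hi hi' hij.symm, mul_add, add_mul]
    abel
  · simp
  · intro k hk1 hk2
    simp only [AddMonoidHom.comp_apply, AddMonoidHom.add_apply, AddMonoidHom.zero_apply]
    rw [S.d_x i k hi hi' hk1 hk2, S.d_x j k hj hj' hk1 hk2]
    split_ifs <;> simp [S.d_one hi hi', S.d_one hj hj']

theorem d_s_s (S : OddSystem a x s d) {p q : ℕ} (h : Adj a p q) (f : R) :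
    d p (s q (s p f)) = s q (s p (d q f)) := by
  obtain ⟨hp, hq, hp', hq', hpq⟩ := id h
  refine S.twisted_ext (A := (d p).comp ((s q).comp (s p)).toAddMonoidHom)
    (B := ((s q).comp (s p)).toAddMonoidHom.comp (d q)) ((s q).comp (s p))
    ((s p).comp ((s q).comp (s p))) ?_ ?_ ?_ f
  · intro f g
    simp [S.leibniz p hp hp']
  · intro f g
    simp [S.leibniz q hq hq', S.s_braid h]
  · intro k hk1 hk2
    simp only [AddMonoidHom.comp_apply, RingHom.toAddMonoidHom_eq_coe, RingHom.comp_apply,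
      AddMonoidHom.coe_coe]
    have hs := S.s_x
    rw [S.d_x q k hq hq' hk1 hk2, hs p k hp hp' hk1 hk2]
    split_ifs with h1 h2 h3 h4 h5 <;>
    · rw [map_neg, hs q _ hq hq' (by omega) (by omega)]
      split_ifs <;> first | omega | skip
      all_goals
        simp only [neg_neg, map_one, map_zero]
        rw [S.d_x p _ hp hp' (by omega) (by omega)]
        split_ifs <;> first | omega | rfl

theorem d_s_d (S : OddSystem a x s d) {p q : ℕ} (h : Adj a p q) (f : R) :
    d q (s p (d q f)) = s p (d q (d p f)) + d p (d q (s p f)) := by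
  obtain ⟨hp, hq, hp', hq', hpq⟩ := id h
  rw [← sub_eq_zero]
  refine S.twisted_ext (A := (d q).comp ((s p).toAddMonoidHom.comp (d q)) -
      ((s p).toAddMonoidHom.comp ((d q).comp (d p)) +
      (d p).comp ((d q).comp (s p).toAddMonoidHom))) (B := 0) (s p)
      ((s p).comp ((s q).comp (s p))) ?_ ?_ ?_ f
  · intro f g
    simp [S.leibniz p hp hp', S.leibniz q hq hq', S.s_braid h.symm, S.d_s_s h.symm, S.d_s_s h,
      S.d_s_self hp hp', mul_add, add_mul, mul_sub, sub_mul]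
    abel
  · simp
  · intro k hk1 hk2
    have e1 := S.d_one hp hp'
    have e2 := S.d_one hq hq'
    simp only [AddMonoidHom.sub_apply, AddMonoidHom.comp_apply, AddMonoidHom.add_apply,
      RingHom.toAddMonoidHom_eq_coe, AddMonoidHom.coe_coe, AddMonoidHom.zero_apply]
    have hu : ∀ i j, 1 ≤ j → j ≤ a → 1 ≤ i → i + 1 ≤ a → d i (x j) = 1 ∨ d i (x j) = 0 := by
      intro i j h1 h2 h3 h4
      rw [S.d_x i j h3 h4 h1 h2]
      split_ifs <;> simp
    have hv : ∃ j, 1 ≤ j ∧ j ≤ a ∧ s p (x k) = -x j := by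
      rw [S.s_x p k hp hp' hk1 hk2]
      split_ifs
      · exact ⟨p + 1, by omega, by omega, rfl⟩
      · exact ⟨p, by omega, by omega, rfl⟩
      · exact ⟨k, by omega, by omega, rfl⟩
    obtain ⟨j, hj1, hj2, hj⟩ := hv
    rw [hj, map_neg]
    rcases hu p k hk1 hk2 hp hp' with h1 | h1 <;> rcases hu q k hk1 hk2 hq hq' with h2 | h2 <;>
      rcases hu q j hj1 hj2 hq hq' with h3 | h3 <;> simp [h1, h2, h3, e1, e2]

theorem d_braid (S : OddSystem a x s d) {p q : ℕ} (h : Adj a p q) (f : R) :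
    d p (d q (d p f)) = d q (d p (d q f)) := by
  obtain ⟨hp, hq, hp', hq', hpq⟩ := id h
  rw [← sub_eq_zero]
  refine S.twisted_ext (A := (d p).comp ((d q).comp (d p)) - (d q).comp ((d p).comp (d q)))
    (B := 0) (RingHom.id _) ((s p).comp ((s q).comp (s p))) ?_ ?_ ?_ f
  · intro f g
    simp [S.leibniz p hp hp', S.leibniz q hq hq', S.d_d_self hp hp', S.d_d_self hq hq',
      S.d_s_s h, S.d_s_s h.symm, S.d_s_d h, S.d_s_d h.symm, S.s_braid h.symm, add_mul,
      mul_sub, sub_mul]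
    abel
  · simp
  · intro k hk1 hk2
    simp only [AddMonoidHom.comp_apply, AddMonoidHom.sub_apply, AddMonoidHom.zero_apply]
    rw [S.d_x p k hp hp' hk1 hk2, S.d_x q k hq hq' hk1 hk2]
    split_ifs <;> simp [S.d_one hp hp', S.d_one hq hq']

end OddSystem

namespace OddSystem

variable {R : Type*} [Ring R] {a : ℕ} {x : ℕ → R} {s : ℕ → R →+* R} {d : ℕ → R →+ R}

theorem addWord_d_far (S : OddSystem a x s d) {i : ℕ} (hi : 1 ≤ i) (hi' : i + 1 ≤ a) {l : List ℕ}
    (hl : ∀ j ∈ l, 1 ≤ j ∧ j + 1 ≤ a ∧ (i + 1 < j ∨ j + 1 < i)) (f : R) :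
    ∃ c : ℤ, addWord d l (d i f) = c • d i (addWord d l f) := by
  induction l with
  | nil => exact ⟨1, by simp [addWord]⟩
  | cons j l ih =>
    obtain ⟨c, hc⟩ := ih fun j hj => hl j (List.mem_cons_of_mem _ hj)
    obtain ⟨h1, h2, h3⟩ := hl j List.mem_cons_self
    refine ⟨-c, ?_⟩
    simp only [addWord, AddMonoidHom.comp_apply]
    rw [hc, map_zsmul, S.d_d_far h1 h2 hi hi' h3.symm, smul_neg, neg_smul]

theorem d_addWord_far (S : OddSystem a x s d) {i : ℕ} (hi : 1 ≤ i) (hi' : i + 1 ≤ a) {l : List ℕ}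
    (hl : ∀ j ∈ l, 1 ≤ j ∧ j + 1 ≤ a ∧ (i + 1 < j ∨ j + 1 < i)) {f : R} (hf : d i f = 0) :
    d i (addWord d l f) = 0 := by
  induction l with
  | nil => exact hf
  | cons j l ih =>
    obtain ⟨h1, h2, h3⟩ := hl j List.mem_cons_self
    simp only [addWord, AddMonoidHom.comp_apply]
    rw [S.d_d_far hi hi' h1 h2 h3, ih fun j hj => hl j (List.mem_cons_of_mem _ hj), map_zero,
      neg_zero]

theorem d_ringWord_far (S : OddSystem a x s d) {i : ℕ} (hi : 1 ≤ i) (hi' : i + 1 ≤ a) {l : List ℕ}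
    (hl : ∀ j ∈ l, 1 ≤ j ∧ j + 1 ≤ a ∧ (i + 1 < j ∨ j + 1 < i)) {f : R} (hf : d i f = 0) :
    d i (ringWord s l f) = 0 := by
  induction l with
  | nil => exact hf
  | cons j l ih =>
    obtain ⟨h1, h2, h3⟩ := hl j List.mem_cons_self
    simp only [ringWord, RingHom.comp_apply]
    rw [S.d_s_far hi hi' h1 h2 h3, ih fun j hj => hl j (List.mem_cons_of_mem _ hj), map_zero,
      neg_zero]

theorem desc_d_succ (S : OddSystem a x s d) {k i : ℕ} (hi : 1 ≤ i) (hik : i + 1 ≤ k)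
    (hk : k + 1 ≤ a) (g : R) :
    ∃ c : ℤ, addWord d (descWord k) (d (i + 1) g) = c • d i (addWord d (descWord k) g) := by
  induction k with
  | zero => omega
  | succ k ih =>
    rw [addWord_desc_succ, addWord_desc_succ]
    rcases Nat.lt_or_ge i k with h | h
    · obtain ⟨c, hc⟩ := ih (by omega) (by omega)
      refine ⟨-c, ?_⟩
      rw [hc, map_zsmul, S.d_d_far (by omega) hk hi (by omega) (by omega), smul_neg, neg_smul]
    · obtain rfl : i = k := by omega
      obtain ⟨j, rfl⟩ : ∃ j, i = j + 1 := ⟨i - 1, by omega⟩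
      obtain ⟨c, hc⟩ := S.addWord_d_far (i := j + 1 + 1) (by omega) hk (l := descWord j)
        (fun m hm => by rw [mem_descWord] at hm; omega) g
      refine ⟨c, ?_⟩
      rw [addWord_desc_succ, addWord_desc_succ, hc, map_zsmul, map_zsmul,
        S.d_braid (p := j + 1) (q := j + 1 + 1) ⟨by omega, by omega, by omega, hk, Or.inl rfl⟩]

theorem d_ringWord_desc (S : OddSystem a x s d) {k i : ℕ} (hi : 1 ≤ i) (hik : i + 1 ≤ k)
    (hk : k + 1 ≤ a) {f : R} (hf : d (i + 1) f = 0) :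
    d i (ringWord s (descWord k) f) = 0 := by
  induction k with
  | zero => omega
  | succ k ih =>
    rw [ringWord_desc_succ]
    rcases Nat.lt_or_ge i k with h | h
    · rw [S.d_s_far hi (by omega) (by omega) hk (by omega), ih (by omega) (by omega), map_zero,
        neg_zero]
    · obtain rfl : i = k := by omega
      obtain ⟨j, rfl⟩ : ∃ j, i = j + 1 := ⟨i - 1, by omega⟩
      rw [ringWord_desc_succ,
        S.d_s_s (p := j + 1) (q := j + 1 + 1) ⟨by omega, by omega, by omega, hk, Or.inl rfl⟩,
        S.d_ringWord_far (by omega) hk (fun m hm => by rw [mem_descWord] at hm; omega) hf,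
        map_zero, map_zero]

theorem desc_d_one (S : OddSystem a x s d) {k : ℕ} (h1 : 1 ≤ k) (hk : k + 1 ≤ a) (g : R) :
    addWord d (descWord k) (d 1 g) = 0 := by
  induction k, h1 using Nat.le_induction with
  | base => exact S.d_d_self le_rfl hk g
  | succ k h1 ih => rw [addWord_desc_succ, ih (by omega), map_zero]

theorem desc_desc (S : OddSystem a x s d) {k j : ℕ} (h1 : 1 ≤ j) (hjk : j ≤ k) (hk : k + 1 ≤ a)
    (g : R) : addWord d (descWord k) (addWord d (descWord j) g) = 0 := by
  induction j, h1 using Nat.le_induction with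
  | base => exact S.desc_d_one (by omega) hk g
  | succ j h1 ih =>
    obtain ⟨c, hc⟩ := S.desc_d_succ h1 hjk hk (addWord d (descWord j) g)
    rw [addWord_desc_succ, hc, ih (by omega), map_zero, smul_zero]

theorem DList_d (S : OddSystem a x s d) {m i : ℕ} (hi : 1 ≤ i) (him : i + 1 ≤ m) (hm : m ≤ a)
    (g : R) : addWord d (DList m) (d i g) = 0 := by
  induction m generalizing i g with
  | zero => omega
  | succ m ih =>
    rw [addWord_DList_succ]
    rcases Nat.lt_or_ge 1 i with h | h
    · obtain ⟨j, rfl⟩ : ∃ j, i = j + 1 := ⟨i - 1, by omega⟩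
      obtain ⟨c, hc⟩ := S.desc_d_succ (i := j) (k := m) (by omega) (by omega) hm g
      rw [hc, map_zsmul, ih (by omega) (by omega) (by omega), smul_zero]
    · obtain rfl : i = 1 := by omega
      rw [S.desc_d_one (by omega) hm, map_zero]

theorem d_DList (S : OddSystem a x s d) {m i : ℕ} (hi : 1 ≤ i) (him : i + 1 ≤ m) (hm : m ≤ a)
    (g : R) : d i (addWord d (DList m) g) = 0 := by
  induction m generalizing g with
  | zero => omega
  | succ m ih =>
    rw [addWord_DList_succ]
    rcases Nat.lt_or_ge i m with h | h
    · exact ih h (by omega) _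
    · obtain rfl : i = m := by omega
      obtain ⟨j, rfl⟩ : ∃ j, i = j + 1 := ⟨i - 1, by omega⟩
      rw [addWord_DList_succ]
      refine S.d_addWord_far hi (by omega) (fun k hk => ?_) ?_
      · have := mem_DList hk
        omega
      · rw [← addWord_desc_succ]
        exact S.desc_desc hi le_rfl hm g

theorem addWord_mul_right (S : OddSystem a x s d) {l : List ℕ}
    (hl : ∀ i ∈ l, 1 ≤ i ∧ i + 1 ≤ a) {e : R} (he : ∀ i ∈ l, d i e = 0) (g : R) :
    addWord d l (g * e) = addWord d l g * e := by
  induction l with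
  | nil => rfl
  | cons i l ih =>
    obtain ⟨h1, h2⟩ := hl i List.mem_cons_self
    simp only [addWord, AddMonoidHom.comp_apply]
    rw [ih (fun j hj => hl j (List.mem_cons_of_mem _ hj))
      fun j hj => he j (List.mem_cons_of_mem _ hj),
      S.d_mul_right h1 h2 (he i List.mem_cons_self)]

theorem ringWord_surjective (S : OddSystem a x s d) {l : List ℕ}
    (hl : ∀ i ∈ l, 1 ≤ i ∧ i + 1 ≤ a) : Function.Surjective (ringWord s l) := by
  induction l with
  | nil => exact Function.surjective_id
  | cons i l ih =>
    obtain ⟨h1, h2⟩ := hl i List.mem_cons_self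
    intro v
    obtain ⟨u, hu⟩ := ih (fun j hj => hl j (List.mem_cons_of_mem _ hj)) (s i v)
    exact ⟨u, by rw [ringWord, RingHom.comp_apply, hu, S.s_s h1 h2]⟩

/-- The element `∂_k ⋯ ∂_1 (x_1 ^ N)`. -/
def eta (x : ℕ → R) (d : ℕ → R →+ R) (k N : ℕ) : R := addWord d (descWord k) (x 1 ^ N)

theorem eta_succ (k N : ℕ) : eta x d (k + 1) N = d (k + 1) (eta x d k N) :=
  addWord_desc_succ d k _

theorem d_x_pow_eq_zero (S : OddSystem a x s d) {i j : ℕ} (h1 : 1 ≤ i) (h2 : i + 1 ≤ a)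
    (h3 : 1 ≤ j) (h4 : j ≤ a) (h5 : j ≠ i) (h6 : j ≠ i + 1) (N : ℕ) : d i (x j ^ N) = 0 := by
  induction N with
  | zero => rw [pow_zero, S.d_one h1 h2]
  | succ N ih => rw [pow_succ, S.leibniz i h1 h2, ih, S.d_x_of_ne h1 h2 h3 h4 h5 h6]; simp

theorem d_eta_far (S : OddSystem a x s d) {i k : ℕ} (hi : 1 ≤ i) (hi' : i + 1 ≤ a)
    (hik : k + 1 < i) (N : ℕ) : d i (eta x d k N) = 0 :=
  S.d_addWord_far hi hi' (fun j hj => by rw [mem_descWord] at hj; omega)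
    (S.d_x_pow_eq_zero hi hi' le_rfl (by omega) (by omega) (by omega) N)

theorem d_eta (S : OddSystem a x s d) {i k : ℕ} (hi : 1 ≤ i) (hik : i ≤ k) (hk : k + 1 ≤ a)
    (N : ℕ) : d i (eta x d k N) = 0 := by
  induction k with
  | zero => omega
  | succ k ih =>
    rw [eta_succ]
    rcases Nat.lt_or_ge k i with h | h
    · obtain rfl : i = k + 1 := by omega
      exact S.d_d_self hi hk _
    rcases Nat.lt_or_ge i k with h' | h'
    · rw [S.d_d_far hi (by omega) (by omega) hk (by omega), ih h (by omega), map_zero, neg_zero]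
    · obtain rfl : i = k := by omega
      obtain ⟨j, rfl⟩ : ∃ j, i = j + 1 := ⟨i - 1, by omega⟩
      rw [eta_succ,
        S.d_braid (p := j + 1) (q := j + 1 + 1) ⟨by omega, by omega, by omega, hk, Or.inl rfl⟩,
        S.d_eta_far (by omega) hk (by omega), map_zero, map_zero]

theorem desc_mul_pow (S : OddSystem a x s d) {k : ℕ} (hk : k + 1 ≤ a) (v : R) :
    ∃ u : ℕ → R, ∀ N, addWord d (descWord k) (v * x 1 ^ N) =
      ringWord s (descWord k) v * eta x d k N + ∑ j ∈ Finset.range k, u j * eta x d j N := by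
  induction k with
  | zero => exact ⟨0, fun N => by simp [descWord, addWord, ringWord, eta]⟩
  | succ k ih =>
    obtain ⟨u, hu⟩ := ih (by omega)
    refine ⟨fun j => if j = k then d (k + 1) (ringWord s (descWord k) v) else d (k + 1) (u j),
      fun N => ?_⟩
    have h : ∀ j ∈ Finset.range k, d (k + 1) (u j * eta x d j N) =
        (if j = k then d (k + 1) (ringWord s (descWord k) v) else d (k + 1) (u j)) *
          eta x d j N := by
      intro j hj
      rw [Finset.mem_range] at hj
      rw [if_neg (by omega), S.d_mul_right (by omega) hk
        (S.d_eta_far (by omega) hk (by omega) N)]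
    rw [addWord_desc_succ, hu N, map_add, map_sum, Finset.sum_congr rfl h, Finset.sum_range_succ,
      S.leibniz _ (by omega) hk, ringWord_desc_succ, eta_succ]
    simp only [if_true]
    abel

theorem eta_succ_succ (S : OddSystem a x s d) {k : ℕ} (hk : k + 2 ≤ a) (N : ℕ) :
    eta x d (k + 1) (N + 1) =
      (-1 : ℤ) ^ k • (eta x d k N - x (k + 2) * eta x d (k + 1) N) := by
  induction k with
  | zero =>
    rw [eta_succ, eta_succ]
    simp only [eta, descWord, addWord, List.range_zero, List.reverse_nil, List.map_nil,
      AddMonoidHom.id_apply, zero_add, pow_zero, one_smul]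
    rw [pow_succ', S.leibniz 1 le_rfl hk, S.d_x_left le_rfl hk, S.s_x_left le_rfl hk, one_mul,
      neg_mul, sub_eq_add_neg]
  | succ k ih =>
    rw [eta_succ, ih (by omega), map_zsmul, map_sub, S.leibniz _ (by omega) hk, ← eta_succ,
      S.d_x_left (i := k + 2) (by omega) hk, S.s_x_left (i := k + 2) (by omega) hk,
      S.d_eta_far (by omega) hk (by omega), pow_succ, mul_neg_one, neg_smul, ← smul_neg]
    congr 1
    simp only [zero_sub, one_mul, neg_mul, neg_add_rev, neg_neg, neg_sub]
    abel

theorem eta_of_lt (S : OddSystem a x s d) {k N : ℕ} (hk : k + 1 ≤ a) (h : N < k) :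
    eta x d k N = 0 := by
  induction N generalizing k with
  | zero =>
    obtain ⟨k, rfl⟩ : ∃ j, k = j + 1 := ⟨k - 1, by omega⟩
    clear h
    induction k with
    | zero => simpa [eta, descWord, addWord] using S.d_one le_rfl hk
    | succ k ih => rw [eta_succ, ih (by omega), map_zero]
  | succ N ih =>
    obtain ⟨k, rfl⟩ : ∃ j, k = j + 1 := ⟨k - 1, by omega⟩
    rw [S.eta_succ_succ hk, ih (by omega) (by omega), ih hk (by omega)]
    simp

theorem eta_self (S : OddSystem a x s d) {k : ℕ} (hk : k + 1 ≤ a) :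
    ∃ c : ℕ, eta x d k k = (-1 : ℤ) ^ c • (1 : R) := by
  induction k with
  | zero => exact ⟨0, by simp [eta, descWord, addWord]⟩
  | succ k ih =>
    obtain ⟨c, hc⟩ := ih (by omega)
    refine ⟨k + c, ?_⟩
    rw [S.eta_succ_succ hk, S.eta_of_lt hk (Nat.lt_succ_self k), mul_zero, sub_zero, hc, smul_smul,
      pow_add]

end OddSystem

namespace OddSystem

variable {R : Type*} [Ring R] {a : ℕ} {x : ℕ → R} {s : ℕ → R →+* R} {d : ℕ → R →+ R}

/-- `DegLe x a m c f` says that `f` has degree at most `c` in the variable `x m`. -/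
inductive DegLe (x : ℕ → R) (a m : ℕ) : ℕ → R → Prop
  | one (c : ℕ) : DegLe x a m c 1
  | add {c : ℕ} {f g : R} : DegLe x a m c f → DegLe x a m c g → DegLe x a m c (f + g)
  | neg {c : ℕ} {f : R} : DegLe x a m c f → DegLe x a m c (-f)
  | var_mul {c j : ℕ} {f : R} : 1 ≤ j → j ≤ a → j ≠ m → DegLe x a m c f → DegLe x a m c (x j * f)
  | top_mul {c : ℕ} {f : R} : DegLe x a m c f → DegLe x a m (c + 1) (x m * f)

namespace DegLe

variable {m c c' : ℕ} {f g : R}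

theorem zero : DegLe x a m c 0 := by
  simpa using (DegLe.one (x := x) (a := a) (m := m) c).add (DegLe.one c).neg

theorem mono (h : DegLe x a m c f) (hc : c ≤ c') : DegLe x a m c' f := by
  induction h generalizing c' with
  | one => exact .one _
  | add _ _ h1 h2 => exact .add (h1 hc) (h2 hc)
  | neg _ h1 => exact .neg (h1 hc)
  | var_mul h1 h2 h3 _ h4 => exact .var_mul h1 h2 h3 (h4 hc)
  | top_mul _ h =>
    obtain ⟨e, rfl⟩ : ∃ e, c' = e + 1 := ⟨c' - 1, by omega⟩
    exact .top_mul (h (by omega))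

theorem mul (hf : DegLe x a m c f) (hg : DegLe x a m c' g) : DegLe x a m (c + c') (f * g) := by
  induction hf with
  | one => rw [one_mul]; exact hg.mono (by omega)
  | add _ _ h1 h2 => rw [add_mul]; exact h1.add h2
  | neg _ h1 => rw [neg_mul]; exact h1.neg
  | var_mul h1 h2 h3 _ h4 => rw [mul_assoc]; exact .var_mul h1 h2 h3 h4
  | top_mul _ h => rw [mul_assoc, Nat.add_right_comm]; exact .top_mul h

theorem sub (hf : DegLe x a m c f) (hg : DegLe x a m c g) : DegLe x a m c (f - g) := by
  rw [sub_eq_add_neg]; exact hf.add hg.neg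

theorem natDegree_le {T : Type*} [Ring T] {Γ : R →+* Polynomial T} {y : ℕ → T} {J : T}
    (hΓ : ∀ j, 1 ≤ j → j ≤ a → j ≠ m → Γ (x j) = Polynomial.C (y j))
    (hΓm : Γ (x m) = Polynomial.C (y m) + Polynomial.C J * Polynomial.X)
    (hf : DegLe x a m c f) : (Γ f).natDegree ≤ c := by
  induction hf with
  | one => simp
  | add _ _ h1 h2 =>
    rw [map_add]
    exact Polynomial.natDegree_add_le_of_degree_le h1 h2
  | neg _ h1 => rwa [map_neg, Polynomial.natDegree_neg]
  | var_mul h1 h2 h3 _ h4 =>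
    rw [map_mul, hΓ _ h1 h2 h3]
    exact (Polynomial.natDegree_C_mul_le _ _).trans h4
  | top_mul _ h =>
    rw [map_mul, hΓm, add_comm]
    refine Polynomial.natDegree_mul_le.trans ?_
    rw [add_comm]
    refine add_le_add h ?_
    rw [add_comm]
    refine Polynomial.natDegree_add_le_of_degree_le (by simp) ?_
    exact (Polynomial.natDegree_C_mul_le _ _).trans Polynomial.natDegree_X_le

end DegLe

theorem exists_degLe (S : OddSystem a x s d) (m : ℕ) (f : R) : ∃ c, DegLe x a m c f := by
  refine S.induct (fun f => ∃ c, DegLe x a m c f) ⟨0, .one 0⟩ ?_ ?_ ?_ f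
  · rintro f g ⟨c, hc⟩ ⟨c', hc'⟩
    exact ⟨c + c', (hc.mono (by omega)).add (hc'.mono (by omega))⟩
  · rintro f ⟨c, hc⟩
    exact ⟨c, hc.neg⟩
  · rintro j f h1 h2 ⟨c, hc⟩
    by_cases h : j = m
    · subst h
      exact ⟨c + 1, hc.top_mul⟩
    · exact ⟨c, hc.var_mul h1 h2 h⟩

theorem degLe_d (S : OddSystem a x s d) {m c i : ℕ} (hm : 1 ≤ m) (hm' : m ≤ a) (h1 : 1 ≤ i)
    (h2 : i + 1 ≤ a) (h3 : m ≠ i) (h4 : m ≠ i + 1) {f : R} (hf : DegLe x a m c f) :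
    DegLe x a m c (d i f) := by
  induction hf with
  | one => rw [S.d_one h1 h2]; exact .zero
  | add _ _ h1 h2 => rw [map_add]; exact h1.add h2
  | neg _ h1 => rw [map_neg]; exact h1.neg
  | @var_mul c j f hj1 hj2 hj3 hf h =>
    rw [S.leibniz i h1 h2, S.s_x i j h1 h2 hj1 hj2, S.d_x i j h1 h2 hj1 hj2]
    refine .add ?_ ?_
    · split_ifs
      · rwa [one_mul]
      · rw [zero_mul]; exact .zero
    · split_ifs <;> rw [neg_mul] <;> exact (h.var_mul (by omega) (by omega) (by omega)).neg
  | top_mul _ h =>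
    rw [S.leibniz i h1 h2, S.s_x_of_ne h1 h2 hm hm' h3 h4, S.d_x_of_ne h1 h2 hm hm' h3 h4, zero_mul,
      zero_add, neg_mul]
    exact h.top_mul.neg

theorem degLe_addWord (S : OddSystem a x s d) {m c : ℕ} (hm : 1 ≤ m) (hm' : m ≤ a) {l : List ℕ}
    (hl : ∀ i ∈ l, 1 ≤ i ∧ i + 1 < m) {f : R} (hf : DegLe x a m c f) :
    DegLe x a m c (addWord d l f) := by
  induction l with
  | nil => exact hf
  | cons i l ih =>
    obtain ⟨h1, h2⟩ := hl i List.mem_cons_self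
    exact S.degLe_d hm hm' h1 (by omega) (by omega) (by omega)
      (ih fun j hj => hl j (List.mem_cons_of_mem _ hj))

theorem degLe_eta (S : OddSystem a x s d) {m k : ℕ} (hk : k + 1 < m) (hm' : m ≤ a) (N : ℕ) :
    DegLe x a m 0 (eta x d k N) := by
  refine S.degLe_addWord (by omega) hm' (fun i hi => by rw [mem_descWord] at hi; omega) ?_
  induction N with
  | zero => rw [pow_zero]; exact .one 0
  | succ N ih => rw [pow_succ']; exact .var_mul le_rfl (by omega) (by omega) ih

/-- A sequence whose degrees in the variable `x m` are uniformly bounded. -/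
def BddDeg (x : ℕ → R) (a m : ℕ) (b : ℕ → R) : Prop := ∃ c, ∀ N, DegLe x a m c (b N)

namespace BddDeg

variable {m : ℕ} {b b' : ℕ → R}

theorem sub (h : BddDeg x a m b) (h' : BddDeg x a m b') : BddDeg x a m fun N => b N - b' N := by
  obtain ⟨c, hc⟩ := h
  obtain ⟨c', hc'⟩ := h'
  exact ⟨c + c', fun N => ((hc N).mono (by omega)).sub ((hc' N).mono (by omega))⟩

theorem sum {ι : Type*} (t : Finset ι) {b : ι → ℕ → R} (h : ∀ j ∈ t, BddDeg x a m (b j)) :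
    BddDeg x a m fun N => ∑ j ∈ t, b j N := by
  classical
  induction t using Finset.induction_on with
  | empty => exact ⟨0, fun N => .zero⟩
  | insert j t hj ih =>
    obtain ⟨c, hc⟩ := h j (Finset.mem_insert_self _ _)
    obtain ⟨c', hc'⟩ := ih fun k hk => h k (Finset.mem_insert_of_mem hk)
    refine ⟨c + c', fun N => ?_⟩
    simp only [Finset.sum_insert hj]
    exact ((hc N).mono (by omega)).add ((hc' N).mono (by omega))

end BddDeg

theorem bddDeg_const_mul (S : OddSystem a x s d) {m : ℕ} (v : R) {b : ℕ → R}
    (h : BddDeg x a m b) : BddDeg x a m fun N => v * b N := by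
  obtain ⟨c, hc⟩ := S.exists_degLe m v
  obtain ⟨c', hc'⟩ := h
  exact ⟨c + c', fun N => hc.mul (hc' N)⟩

theorem bddDeg_DList_sub (S : OddSystem a x s d) {m : ℕ} (hm : m + 1 ≤ a) (v : R) :
    BddDeg x a (m + 1) fun N => addWord d (DList (m + 1)) (v * x 1 ^ N) -
      addWord d (DList m) (ringWord s (descWord m) v) * eta x d m N := by
  obtain ⟨u, hu⟩ := S.desc_mul_pow hm v
  have h : ∀ N, addWord d (DList (m + 1)) (v * x 1 ^ N) -
      addWord d (DList m) (ringWord s (descWord m) v) * eta x d m N =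
      ∑ j ∈ Finset.range m, addWord d (DList m) (u j * eta x d j N) := by
    intro N
    rw [addWord_DList_succ, hu N, map_add, map_sum, S.addWord_mul_right (l := DList m)
      (fun i hi => by have := mem_DList hi; omega)
      (fun i hi => by have := mem_DList hi; exact S.d_eta (by omega) (by omega) hm N)]
    abel
  simp only [h]
  refine BddDeg.sum _ fun j hj => ?_
  rw [Finset.mem_range] at hj
  obtain ⟨c, hc⟩ := S.exists_degLe (m + 1) (u j)
  exact ⟨c + 0, fun N => S.degLe_addWord (by omega) hm
    (fun i hi => by have := mem_DList hi; omega) (hc.mul (S.degLe_eta (by omega) hm N))⟩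

theorem bddDeg_mul_eta (S : OddSystem a x s d) {m : ℕ} (hm : m + 1 ≤ a) {E : R →+ R}
    (hE : ∀ i g, 1 ≤ i → i ≤ m → E (d i g) = 0)
    (hE' : ∀ v, BddDeg x a (m + 1) fun N => E (v * x 1 ^ N)) (k : ℕ) (hk : k ≤ m) (v : R) :
    BddDeg x a (m + 1) fun N => E (v * eta x d k N) := by
  induction k using Nat.strong_induction_on generalizing v with
  | _ k ih =>
    obtain ⟨w, rfl⟩ := S.ringWord_surjective (l := descWord k)
      (fun i hi => by rw [mem_descWord] at hi; omega) v
    obtain ⟨u, hu⟩ := S.desc_mul_pow (k := k) (by omega) w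
    have h : ∀ N, E (ringWord s (descWord k) w * eta x d k N) =
        E (addWord d (descWord k) (w * x 1 ^ N)) -
          ∑ j ∈ Finset.range k, E (u j * eta x d j N) := by
      intro N
      rw [hu N, map_add, map_sum, add_sub_cancel_right]
    simp only [h]
    refine BddDeg.sub ?_ (BddDeg.sum _ fun j hj => ?_)
    · cases k with
      | zero => exact hE' w
      | succ k =>
        refine ⟨0, fun N => ?_⟩
        simp only [addWord_desc_succ, hE _ _ (Nat.succ_pos k) hk]
        exact .zero
    · rw [Finset.mem_range] at hj
      exact ih j hj (by omega) (u j)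

/-- A faithful realisation in which `x m` becomes a polynomial of degree one with invertible
leading coefficient and the other variables become constants. -/
def Separating {T : Type*} [Ring T] (x : ℕ → R) (a m : ℕ) (Γ : R →+* Polynomial T) : Prop :=
  Function.Injective Γ ∧ ∃ (y : ℕ → T) (J : T), IsUnit J ∧
    (∀ j, 1 ≤ j → j ≤ a → j ≠ m → Γ (x j) = Polynomial.C (y j)) ∧
    Γ (x m) = Polynomial.C (y m) + Polynomial.C J * Polynomial.X

theorem natDegree_eta (S : OddSystem a x s d) {T : Type*} [Ring T] {m : ℕ} (hm : m + 1 ≤ a)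
    {Γ : R →+* Polynomial T} (hΓ : Separating x a (m + 1) Γ) (n : ℕ) :
    (Γ (eta x d m (m + n))).natDegree ≤ n ∧ IsUnit ((Γ (eta x d m (m + n))).coeff n) := by
  obtain ⟨-, y, J, hJ, hy, hJm⟩ := hΓ
  induction n with
  | zero =>
    obtain ⟨c, hc⟩ := S.eta_self hm
    rw [add_zero, hc, map_zsmul, map_one]
    rcases neg_one_pow_eq_or ℤ c with h | h <;> simp [h]
  | succ n ih =>
    obtain ⟨h1, h2⟩ := ih
    have h3 : ∃ (e : ℕ) (f : R), DegLe x a (m + 1) 0 f ∧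
        eta x d m (m + (n + 1)) = (-1 : ℤ) ^ e • (f - x (m + 1) * eta x d m (m + n)) := by
      cases m with
      | zero =>
        refine ⟨1, 0, .zero, ?_⟩
        simp [eta, descWord, addWord, ← add_assoc, pow_succ']
      | succ m => exact ⟨m, _, S.degLe_eta (by omega) hm _, S.eta_succ_succ hm _⟩
    obtain ⟨e, f, hf, he⟩ := h3
    have hf' := hf.natDegree_le hy hJm
    have h4 : (Γ (f - x (m + 1) * eta x d m (m + n))).natDegree ≤ n + 1 := by
      rw [map_sub, map_mul, hJm]
      refine (Polynomial.natDegree_sub_le_of_le (hf'.trans (Nat.zero_le (n + 1)))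
        (n := n + 1) ?_).trans (max_self _).le
      refine Polynomial.natDegree_mul_le.trans ?_
      rw [add_comm]
      refine add_le_add h1 ?_
      refine Polynomial.natDegree_add_le_of_degree_le (by simp) ?_
      exact (Polynomial.natDegree_C_mul_le _ _).trans Polynomial.natDegree_X_le
    have h5 : IsUnit ((Γ (f - x (m + 1) * eta x d m (m + n))).coeff (n + 1)) := by
      rw [map_sub, map_mul, hJm, Polynomial.coeff_sub,
        Polynomial.coeff_eq_zero_of_natDegree_lt (by omega), zero_sub, IsUnit.neg_iff, add_mul,
        Polynomial.coeff_add, Polynomial.coeff_C_mul,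
        Polynomial.coeff_eq_zero_of_natDegree_lt (by omega), mul_zero, zero_add, mul_assoc,
        Polynomial.coeff_C_mul, Polynomial.coeff_X_mul]
      exact hJ.mul h2
    rw [he, map_zsmul]
    rcases neg_one_pow_eq_or ℤ e with h | h
    · rw [h, one_smul]
      exact ⟨h4, h5⟩
    · rw [h, neg_smul, one_smul, Polynomial.natDegree_neg, Polynomial.coeff_neg, IsUnit.neg_iff]
      exact ⟨h4, h5⟩

theorem eq_zero_of_bddDeg (S : OddSystem a x s d) {T : Type*} [Ring T] {m : ℕ} (hm : m + 1 ≤ a)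
    {Γ : R →+* Polynomial T} (hΓ : Separating x a (m + 1) Γ) {v : R}
    (hv : BddDeg x a (m + 1) fun N => v * eta x d m N) : v = 0 := by
  obtain ⟨c, hc⟩ := hv
  obtain ⟨h1, h2⟩ := S.natDegree_eta hm hΓ (c + 1)
  obtain ⟨hinj, y, J, -, hy, hJm⟩ := hΓ
  have h3 := (hc (m + (c + 1))).natDegree_le hy hJm
  rw [map_mul] at h3
  have h4 := Polynomial.coeff_mul_add_eq_of_natDegree_le (le_refl (Γ v).natDegree) h1
  rw [Polynomial.coeff_eq_zero_of_natDegree_lt (by omega)] at h4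
  have h5 : (Γ v).leadingCoeff = 0 := h2.mul_left_eq_zero.mp h4.symm
  rw [Polynomial.leadingCoeff_eq_zero] at h5
  exact hinj (h5.trans (map_zero Γ).symm)

/-- Left linearity of the composite operator over elements killed by its constituents. -/
theorem DList_mul (S : OddSystem a x s d) {T : Type*} [Ring T]
    (hT : ∀ m, 1 ≤ m → m ≤ a → ∃ Γ : R →+* Polynomial T, Separating x a m Γ) {m : ℕ}
    (hm : m ≤ a) {f : R} (hf : ∀ i, 1 ≤ i → i + 1 ≤ m → d i f = 0) (g : R) :
    addWord d (DList m) (f * g) = ringWord s (DList m) f * addWord d (DList m) g := by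
  induction m generalizing f g with
  | zero => simp [DList, addWord, ringWord]
  | succ m ih =>
    obtain ⟨Γ, hΓ⟩ := hT (m + 1) (by omega) hm
    let E : R →+ R := (addWord d (DList (m + 1))).comp (AddMonoidHom.mulLeft f) -
      (AddMonoidHom.mulLeft (ringWord s (DList (m + 1)) f)).comp (addWord d (DList (m + 1)))
    have hE : ∀ v, E v = addWord d (DList (m + 1)) (f * v) -
      ringWord s (DList (m + 1)) f * addWord d (DList (m + 1)) v := fun v => rfl
    have h1 : ∀ i g, 1 ≤ i → i ≤ m → E (d i g) = 0 := by
      intro i g hi him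
      have h2 : f * d i g = d i (s i f * g) := by
        rw [S.leibniz i hi (by omega), S.d_s_self hi (by omega), hf i hi (by omega),
          S.s_s hi (by omega), map_zero, neg_zero, zero_mul, zero_add]
      rw [hE, h2, S.DList_d hi (by omega) hm, S.DList_d hi (by omega) hm, mul_zero, sub_zero]
    have h2 : ∀ v, BddDeg x a (m + 1) fun N => E (v * x 1 ^ N) := by
      intro v
      have h3 := (S.bddDeg_DList_sub hm (f * v)).sub
        (S.bddDeg_const_mul (ringWord s (DList (m + 1)) f) (S.bddDeg_DList_sub hm v))
      have h4 := ih (f := ringWord s (descWord m) f) (by omega)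
        (fun i hi him => S.d_ringWord_desc hi him hm (hf (i + 1) (by omega) (by omega)))
        (ringWord s (descWord m) v)
      rw [← map_mul, ← ringWord_DList_succ] at h4
      refine (congrArg (BddDeg x a (m + 1)) (funext fun N => ?_)).mp h3
      rw [hE, h4, mul_assoc f v]
      simp only [mul_sub, mul_assoc]
      abel
    have h3 : E g = 0 := by
      refine S.eq_zero_of_bddDeg hm hΓ ?_
      have h4 := S.bddDeg_mul_eta hm h1 h2 m le_rfl g
      refine (congrArg (BddDeg x a (m + 1)) (funext fun N => ?_)).mp h4
      have h5 : ∀ i ∈ DList (m + 1), d i (eta x d m N) = 0 := fun i hi => by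
        have := mem_DList hi
        exact S.d_eta (by omega) (by omega) hm N
      have h6 : ∀ i ∈ DList (m + 1), 1 ≤ i ∧ i + 1 ≤ a := fun i hi => by
        have := mem_DList hi
        omega
      rw [hE, hE, ← mul_assoc, S.addWord_mul_right h6 h5, S.addWord_mul_right h6 h5, sub_mul,
        mul_assoc]
    exact sub_eq_zero.mp h3

end OddSystem

theorem commute_pow_pow_succ_of_anticomm {R : Type*} [Ring R] {u v : R} (h : u * v = -(v * u))
    (r : ℕ) : Commute (u ^ r) (v ^ (r + 1)) := by
  have key : ∀ u v : R, u * v = -(v * u) → Commute (u * u) v := fun u v h => by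
    change u * u * v = v * (u * u)
    rw [mul_assoc, h, mul_neg, ← mul_assoc, h, neg_mul, neg_neg, mul_assoc]
  rcases Nat.even_or_odd' r with ⟨k, rfl | rfl⟩
  · rw [pow_mul, sq]
    exact ((key u v h).pow_left k).pow_right _
  · rw [show 2 * k + 1 + 1 = 2 * (k + 1) by ring, pow_mul v, sq]
    exact ((key v u (by rw [h, neg_neg])).symm.pow_left _).pow_right _

theorem neg_pow_eq_zsmul {R : Type*} [Ring R] (y : R) (n : ℕ) :
    (-y) ^ n = (-1 : ℤ) ^ n • y ^ n := by
  rcases Nat.even_or_odd n with h | h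
  · rw [h.neg_pow, h.neg_one_pow, one_smul]
  · rw [h.neg_pow, h.neg_one_pow, neg_smul, one_smul]

/-- The product `x_1 ^ N * x_2 ^ (N - 1) * ⋯ * x_k ^ (N - k + 1)`. -/
def stair {R : Type*} [Ring R] (x : ℕ → R) (N : ℕ) : ℕ → R
  | 0 => 1
  | k + 1 => stair x N k * x (k + 1) ^ (N - k)

/-- The product `x_{k+1} ^ n * x_{k+2} ^ (n - 1) * ⋯ * x_{k+n}`. -/
def stairTail {R : Type*} [Ring R] (x : ℕ → R) : ℕ → ℕ → R
  | _, 0 => 1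
  | k, n + 1 => x (k + 1) ^ (n + 1) * stairTail x (k + 1) n

theorem stair_mul_stairTail {R : Type*} [Ring R] (x : ℕ → R) (k j : ℕ) :
    stair x (k + j) k * stairTail x k j = stair x (k + j) (k + j) := by
  induction j generalizing k with
  | zero => simp [stairTail]
  | succ j ih =>
    rw [stairTail, ← mul_assoc, show k + (j + 1) = k + 1 + j by ring, ← ih (k + 1), stair,
      show k + 1 + j - k = j + 1 by omega]

/-- The exponent of the sign produced by moving a staircase through `∂_n ⋯ ∂_1`. -/
def stairSign (n : ℕ) : ℕ := ∑ k ∈ Finset.range n, ∑ i ∈ Finset.range k, (n - 1 - i)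

theorem stairSign_succ (n : ℕ) : stairSign (n + 1) = stairSign n + n * n := by
  unfold stairSign
  rw [Finset.sum_range_succ']
  simp only [Finset.sum_range_succ', Finset.sum_add_distrib, Finset.sum_range_zero, add_zero]
  simp [Nat.sub_sub, add_comm]

theorem neg_one_pow_stairSign (n : ℕ) : (-1 : ℤ) ^ stairSign n = (-1) ^ n.choose 2 := by
  induction n with
  | zero => rfl
  | succ n ih =>
    rw [stairSign_succ, pow_add, ih, pow_mul, Nat.choose_succ_succ' n 1, Nat.choose_one_right,
      pow_add, mul_comm]
    rcases neg_one_pow_eq_or ℤ n with h | h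
    · simp [h]
    · have hn : Odd n := by
        by_contra hn
        rw [Nat.not_odd_iff_even] at hn
        rw [hn.neg_one_pow] at h
        norm_num at h
      rw [h, hn.neg_one_pow]

namespace OddSystem

variable {R : Type*} [Ring R] {a : ℕ} {x : ℕ → R} {s : ℕ → R →+* R} {d : ℕ → R →+ R}

theorem d_pow_mul_pow (S : OddSystem a x s d) {i : ℕ} (h1 : 1 ≤ i) (h2 : i + 1 ≤ a) (r : ℕ) :
    d i (x i ^ r * x (i + 1) ^ r) = 0 ∧
      d i (x i ^ (r + 1) * x (i + 1) ^ r) = x i ^ r * x (i + 1) ^ r := by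
  have step : ∀ r, d i (x i ^ r * x (i + 1) ^ r) = 0 →
      d i (x i ^ (r + 1) * x (i + 1) ^ r) = x i ^ r * x (i + 1) ^ r := by
    intro r h
    rw [pow_succ', mul_assoc, S.d_mul_right h1 h2 h, S.d_x_left h1 h2, one_mul]
  suffices h : d i (x i ^ r * x (i + 1) ^ r) = 0 from ⟨h, step r h⟩
  induction r with
  | zero => simpa using S.d_one h1 h2
  | succ r ih =>
    have hc := commute_pow_pow_succ_of_anticomm (S.anticomm i (i + 1) (by omega)) r
    rw [pow_succ (x (i + 1)), ← mul_assoc, S.leibniz i h1 h2, step r ih, S.d_x_right h1 h2, mul_one,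
      map_mul, map_pow, map_pow, S.s_x_left h1 h2, S.s_x_right h1 h2, mul_assoc, ← pow_succ,
      hc.eq, neg_pow, neg_pow (x i), mul_assoc, ← mul_assoc _ ((-1) ^ r),
      ← ((Commute.neg_one_left (x (i + 1) ^ (r + 1))).pow_left r).eq, mul_assoc, ← mul_assoc,
      ← pow_add, show r + 1 + r = 2 * r + 1 by ring, Odd.neg_one_pow ⟨r, rfl⟩, neg_one_mul,
      add_neg_cancel]

theorem d_stair (S : OddSystem a x s d) {i k : ℕ} (h1 : k < i) (h2 : i + 1 ≤ a) (N : ℕ) :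
    d i (stair x N k) = 0 := by
  induction k with
  | zero => exact S.d_one (by omega) h2
  | succ k ih =>
    rw [stair, S.d_mul_right (by omega) h2
      (S.d_x_pow_eq_zero (by omega) h2 (by omega) (by omega) (by omega) (by omega) _),
      ih (by omega), zero_mul]

theorem s_stair (S : OddSystem a x s d) {i k : ℕ} (h1 : k < i) (h2 : i + 1 ≤ a) (N : ℕ) :
    s i (stair x N k) = (-1 : ℤ) ^ (∑ j ∈ Finset.range k, (N - j)) • stair x N k := by
  induction k with
  | zero => simp [stair]
  | succ k ih =>
    rw [stair, map_mul, ih (by omega), map_pow, S.s_x_of_ne (by omega) h2 (by omega) (by omega)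
      (by omega) (by omega), Finset.sum_range_succ, pow_add]
    rw [neg_pow_eq_zsmul (x (k + 1)), smul_mul_smul_comm]

theorem d_stairTail (S : OddSystem a x s d) {i k n : ℕ} (h1 : 1 ≤ i) (h2 : i < k)
    (h3 : k + n ≤ a) : d i (stairTail x k n) = 0 := by
  induction n generalizing k with
  | zero => exact S.d_one h1 (by omega)
  | succ n ih =>
    rw [stairTail, S.d_mul_right h1 (by omega) (ih (by omega) (by omega)),
      S.d_x_pow_eq_zero h1 (by omega) (by omega) (by omega) (by omega) (by omega), zero_mul]

theorem d_stairTail_succ (S : OddSystem a x s d) {k j : ℕ} (h : k + j + 2 ≤ a) :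
    d (k + 1) (stairTail x k (j + 1)) = x (k + 1) ^ j * stairTail x (k + 1) j := by
  have h1 : 1 ≤ k + 1 := by omega
  have h2 : k + 1 + 1 ≤ a := by omega
  cases j with
  | zero => simpa [stairTail] using S.d_x_left h1 h2
  | succ j =>
    rw [stairTail, stairTail, ← mul_assoc, S.d_mul_right h1 h2 (S.d_stairTail h1 (by omega)
      (by omega)), (S.d_pow_mul_pow h1 h2 (j + 1)).2, mul_assoc]

theorem desc_stair (S : OddSystem a x s d) {n k : ℕ} (hk : k ≤ n) (hn : n + 1 ≤ a) :
    addWord d (descWord k) (stair x n n) =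
      (-1 : ℤ) ^ (∑ j ∈ Finset.range k, ∑ i ∈ Finset.range j, (n - 1 - i)) •
        (stair x (n - 1) k * stairTail x k (n - k)) := by
  induction k with
  | zero =>
    have := stair_mul_stairTail x 0 n
    simp only [zero_add] at this
    simp [descWord, addWord, ← this, stair]
  | succ k ih =>
    obtain ⟨j, rfl⟩ : ∃ j, n = k + j + 1 := ⟨n - k - 1, by omega⟩
    rw [addWord_desc_succ, ih (by omega), map_zsmul, S.leibniz _ (by omega) (by omega),
      S.d_stair (by omega) (by omega), zero_mul, zero_add, S.s_stair (by omega) (by omega),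
      show k + j + 1 - k = j + 1 by omega, S.d_stairTail_succ (by omega), smul_mul_assoc, smul_smul,
      ← pow_add, Finset.sum_range_succ, stair, show k + j + 1 - (k + 1) = j by omega,
      show k + j + 1 - 1 - k = j by omega, mul_assoc]

theorem DList_stair (S : OddSystem a x s d) {n : ℕ} (hn : n + 1 ≤ a) :
    addWord d (DList (n + 1)) (stair x n n) = (-1 : ℤ) ^ (n + 1).choose 3 • (1 : R) := by
  induction n with
  | zero => simp [DList, addWord, stair, Nat.choose_eq_zero_of_lt]
  | succ n ih =>
    rw [addWord_DList_succ, S.desc_stair le_rfl hn, Nat.sub_self, stairTail, mul_one,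
      Nat.add_sub_cancel, stair, Nat.sub_self, pow_zero, mul_one, map_zsmul, ih (by omega)]
    have h := neg_one_pow_stairSign (n + 1)
    simp only [stairSign, Nat.add_sub_cancel] at h
    rw [h, smul_smul, ← pow_add, Nat.choose_succ_succ' (n + 1) 2]

theorem ringWord_desc_x (S : OddSystem a x s d) {k i : ℕ} (hk : k + 1 ≤ a) (h1 : 1 ≤ i)
    (h2 : i ≤ a) : ringWord s (descWord k) (x i) =
      (-1 : ℤ) ^ k • x (if i = 1 then k + 1 else if i ≤ k + 1 then i - 1 else i) := by
  induction k with
  | zero =>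
    have : (if i = 1 then 0 + 1 else if i ≤ 0 + 1 then i - 1 else i) = i := by
      split_ifs <;> omega
    rw [this]
    simp [descWord, ringWord]
  | succ k ih =>
    rw [ringWord_desc_succ, ih (by omega), map_zsmul, pow_succ, mul_neg_one, neg_smul, ← smul_neg]
    congr 1
    by_cases h : i = 1
    · rw [if_pos h, if_pos h, S.s_x_left (by omega) hk]
    rw [if_neg h, if_neg h]
    by_cases h' : i ≤ k + 1
    · rw [if_pos h', if_pos (by omega),
        S.s_x_of_ne (by omega) hk (by omega) (by omega) (by omega) (by omega)]
    rw [if_neg h']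
    by_cases h'' : i = k + 2
    · subst h''
      rw [if_pos (by omega), S.s_x_right (by omega) hk]
      rfl
    · rw [if_neg (by omega), S.s_x_of_ne (by omega) hk h1 h2 (by omega) (by omega)]

theorem ringWord_DList_x (S : OddSystem a x s d) {m i : ℕ} (hm : m ≤ a) (h1 : 1 ≤ i)
    (h2 : i ≤ a) : ringWord s (DList m) (x i) =
      (-1 : ℤ) ^ m.choose 2 • x (if i ≤ m then m + 1 - i else i) := by
  induction m generalizing i with
  | zero => simp [DList, ringWord, show ¬ i = 0 by omega]
  | succ m ih =>
    rw [ringWord_DList_succ, S.ringWord_desc_x hm h1 h2, map_zsmul, ih (by omega)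
      (by split_ifs <;> omega) (by split_ifs <;> omega), smul_smul, ← pow_add,
      Nat.choose_succ_succ' m 1, Nat.choose_one_right]
    congr 2
    split_ifs <;> omega

theorem d_reverse_eq_zero (S : OddSystem a x s d) {W : R →+* R} {c : ℕ}
    (hW : ∀ j, 1 ≤ j → j ≤ a → W (x j) = (-1 : ℤ) ^ c • x (a + 1 - j)) {i : ℕ} (h1 : 1 ≤ i)
    (h2 : i + 1 ≤ a) {f : R} (hf : d (a - i) f = 0) : d i (W f) = 0 := by
  have h3 : 1 ≤ a - i := by omega
  have h4 : a - i + 1 ≤ a := by omega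
  have hs : ∀ f, s i (W f) = W (s (a - i) f) := by
    intro f
    refine S.ringHom_ext (A := (s i).comp W) (B := W.comp (s (a - i))) ?_ f
    intro j hj1 hj2
    simp only [RingHom.comp_apply]
    rw [hW j hj1 hj2, map_zsmul, S.s_x i _ h1 h2 (by omega) (by omega),
      S.s_x (a - i) j h3 h4 hj1 hj2]
    by_cases h : j = a - i
    · rw [if_neg (by omega), if_pos (by omega), if_pos h, map_neg, hW _ (by omega) h4, smul_neg,
        show a + 1 - (a - i + 1) = i by omega]
    by_cases h' : j = a - i + 1
    · rw [if_pos (by omega), if_neg h, if_pos h', map_neg, hW _ h3 (by omega), smul_neg,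
        show a + 1 - (a - i) = i + 1 by omega]
    · rw [if_neg (by omega), if_neg (by omega), if_neg h, if_neg h', map_neg, hW _ hj1 hj2,
        smul_neg]
  have key := S.twisted_ext (A := (d i).comp W.toAddMonoidHom)
    (B := (-1 : ℤ) ^ c • W.toAddMonoidHom.comp (d (a - i))) W ((s i).comp W) ?_ ?_ ?_ f
  · simpa [hf] using key
  · intro f g
    simp [S.leibniz i h1 h2]
  · intro f g
    rcases neg_one_pow_eq_or ℤ c with h | h
    · simp [S.leibniz (a - i) h3 h4, hs, h]
    · simp [S.leibniz (a - i) h3 h4, hs, h, add_comm]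
  · intro j hj1 hj2
    simp only [AddMonoidHom.comp_apply, AddMonoidHom.smul_apply, RingHom.toAddMonoidHom_eq_coe,
      AddMonoidHom.coe_coe]
    rw [hW j hj1 hj2, map_zsmul, S.d_x i _ h1 h2 (by omega) (by omega),
      S.d_x (a - i) j h3 h4 hj1 hj2]
    congr 1
    split_ifs <;> first | omega | simp

theorem neg_one_pow_mul_eq_zsmul (c : ℕ) (f : R) : (-1 : R) ^ c * f = (-1 : ℤ) ^ c • f := by
  simp

/-- The odd symmetrization is a left linear projection onto the odd symmetric elements. -/
theorem symmetrization (S : OddSystem a x s d) {T : Type*} [Ring T]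
    (hT : ∀ m, 1 ≤ m → m ≤ a → ∃ Γ : R →+* Polynomial T, Separating x a m Γ) {W : R →+* R}
    (hW : ∀ j, 1 ≤ j → j ≤ a → W (x j) = (-1 : R) ^ a.choose 2 * x (a + 1 - j)) {P : R → R}
    (hP : ∀ f, P f = (-1 : R) ^ a.choose 3 *
      W (addWord d (DList a) (f * stair x (a - 1) (a - 1)))) :
    (∀ f i, 1 ≤ i → i + 1 ≤ a → d i (P f) = 0) ∧
    (∀ f, (∀ i, 1 ≤ i → i + 1 ≤ a → d i f = 0) → P f = f) ∧
    (∀ f, P (P f) = P f) ∧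
    (∀ f g, (∀ i, 1 ≤ i → i + 1 ≤ a → d i f = 0) → P (f * g) = f * P g) := by
  simp only [neg_one_pow_mul_eq_zsmul] at hW hP
  have hWW : ∀ f, W (ringWord s (DList a) f) = f := by
    intro f
    refine S.ringHom_ext (A := W.comp (ringWord s (DList a))) (B := RingHom.id R) ?_ f
    intro j h1 h2
    rw [RingHom.comp_apply, S.ringWord_DList_x le_rfl h1 h2, if_pos h2, map_zsmul,
      hW _ (by omega) (by omega), smul_smul, ← mul_pow, show a + 1 - (a + 1 - j) = j by omega]
    simp
  have hlin : ∀ f g, (∀ i, 1 ≤ i → i + 1 ≤ a → d i f = 0) → P (f * g) = f * P g := by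
    intro f g hf
    rw [hP, hP, mul_assoc, S.DList_mul hT le_rfl hf, map_mul, hWW, mul_smul_comm]
  have hone : P 1 = 1 := by
    have h : addWord d (DList a) (stair x (a - 1) (a - 1)) = (-1 : ℤ) ^ a.choose 3 • (1 : R) := by
      rcases Nat.eq_zero_or_pos a with h | h
      · subst h
        simp [DList, addWord, stair]
      · have := S.DList_stair (n := a - 1) (by omega)
        rwa [Nat.sub_add_cancel h] at this
    rw [hP, one_mul, h, map_zsmul, map_one, smul_smul, ← mul_pow]
    simp
  have hfix : ∀ f, (∀ i, 1 ≤ i → i + 1 ≤ a → d i f = 0) → P f = f := by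
    intro f hf
    rw [← mul_one f, hlin f 1 hf, hone]
  have hker : ∀ f i, 1 ≤ i → i + 1 ≤ a → d i (P f) = 0 := by
    intro f i h1 h2
    rw [hP, map_zsmul, S.d_reverse_eq_zero hW h1 h2 (S.d_DList (by omega) (by omega) le_rfl _),
      smul_zero]
  exact ⟨hker, hfix, fun f => hfix _ (hker f), hlin⟩

end OddSystem

theorem linear_mul_C_of_anticomm {T : Type*} [Ring T] {l l' J : T} (h : l * l' = -(l' * l))
    (hJ : J * l' = -(l' * J)) :
    (Polynomial.C l + Polynomial.C J * Polynomial.X) * Polynomial.C l' =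
      -(Polynomial.C l' * (Polynomial.C l + Polynomial.C J * Polynomial.X)) := by
  rw [add_mul, mul_add, mul_assoc, Polynomial.X_mul_C, ← mul_assoc, ← mul_assoc, ← map_mul,
    ← map_mul, ← map_mul, ← map_mul, h, hJ, map_neg, map_neg, neg_mul, neg_add]

theorem stair_eq_prod {R : Type*} [Ring R] (x : ℕ → R) (N k : ℕ) :
    stair x N k = ((List.range k).map fun i => x (i + 1) ^ (N - i)).prod := by
  induction k with
  | zero => rfl
  | succ k ih => rw [stair, ih, List.range_succ, List.map_append, List.prod_append]; simp

namespace OPol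

variable {a : ℕ}

theorem parityEnd_mul_mulLeftHom (i : Fin a) :
    parityEnd a * mulLeftHom a (OX i) = -(mulLeftHom a (OX i) * parityEnd a) :=
  AddMonoidHom.ext fun g => ((map_mul (parity a) (OX i) g).trans
    (congrArg (fun f => f * parity a g) (parity_OX i))).trans (neg_mul (OX i) (parity a g))

theorem mulLeftHom_injective : Function.Injective (mulLeftHom a) := fun f g h => by
  have h1 : f * 1 = g * 1 := DFunLike.congr_fun h 1
  rwa [mul_one, mul_one] at h1

theorem exists_separating {T : Type*} [Ring T] {L : OPol a →+* T} (hL : Function.Injective L)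
    {J : T} (hJ : IsUnit J) (hJL : ∀ i, J * L (OX i) = -(L (OX i) * J)) {m : ℕ} (h1 : 1 ≤ m)
    (h2 : m ≤ a) : ∃ Γ : OPol a →+* Polynomial T, OddSystem.Separating (xv a) a m Γ := by
  have hLL : ∀ i j : Fin a, i ≠ j → L (OX i) * L (OX j) = -(L (OX j) * L (OX i)) := by
    intro i j h
    rw [← map_mul, ← map_mul, ← map_neg, OX_anticomm h]
  let y : Fin a → Polynomial (T) := fun i =>
    if (i : ℕ) + 1 = m then
      Polynomial.C (L (OX i)) + Polynomial.C (J) * Polynomial.X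
    else Polynomial.C (L (OX i))
  have hy : ∀ i j, i ≠ j → y i * y j = -(y j * y i) := by
    intro i j hij
    have hij' : (i : ℕ) ≠ j := fun h => hij (Fin.ext h)
    by_cases hi : (i : ℕ) + 1 = m <;> by_cases hj : (j : ℕ) + 1 = m
    · omega
    · simp only [y, if_pos hi, if_neg hj]
      exact linear_mul_C_of_anticomm (hLL _ _ hij) (hJL j)
    · simp only [y, if_neg hi, if_pos hj]
      rw [linear_mul_C_of_anticomm (hLL _ _ hij.symm) (hJL i),
        neg_neg]
    · simp only [y, if_neg hi, if_neg hj]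
      rw [← map_mul Polynomial.C, ← map_mul Polynomial.C, ← map_neg, hLL _ _ hij]
  have hx : ∀ j (h1 : 1 ≤ j) (h2 : j ≤ a), lift y hy (xv a j) = y ⟨j - 1, by omega⟩ := by
    intro j h1 h2
    rw [xv_of_le h1 h2, lift_OX]
  refine ⟨lift y hy, ?_, fun j => L (xv a j), J, hJ, ?_, ?_⟩
  · have key : ∀ f, Polynomial.constantCoeff (lift y hy f) = L f := by
      intro f
      refine ringHom_ext (A := Polynomial.constantCoeff.comp (lift y hy)) (B := L) ?_ f
      intro j h1 h2
      rw [RingHom.comp_apply, hx j h1 h2, xv_of_le h1 h2]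
      simp only [y]
      split_ifs <;> simp
    intro f g h
    exact hL (by rw [← key, ← key, h])
  · intro j h1 h2 hj
    simp only [xv_of_le h1 h2, lift_OX]
    exact if_neg (by change ¬ j - 1 + 1 = m; omega)
  · simp only [xv_of_le h1 h2, lift_OX]
    exact if_pos (by change m - 1 + 1 = m; omega)

theorem dword_eq_addWord (d : ℕ → OPol a →+ OPol a) (l : List ℕ) : dword d l = addWord d l := by
  induction l with
  | nil => rfl
  | cons i l ih => rw [dword, addWord, ih]

theorem xdelta_eq_stair : xdelta a = stair (xv a) (a - 1) (a - 1) := by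
  have h : xdelta a = stair (xv a) (a - 1) a := by
    rw [stair_eq_prod, xdelta, ← List.map_coe_finRange_eq_range, List.map_map]
    congr 1
    refine List.map_congr_left fun i _ => ?_
    rw [OX_eq_xv]
    rfl
  rw [h]
  cases a with
  | zero => rfl
  | succ n => rw [Nat.add_sub_cancel, stair, Nat.sub_self, pow_zero, mul_one]

end OPol

/-- the odd symmetrization operator is a left OΛ_a-linear projection
of OPol_a onto OΛ_a. -/
theorem odd_symmetrization_projection (a : ℕ)
    (s : ℕ → OPol a →+* OPol a)
    (hs : ∀ i j : ℕ, 1 ≤ i → i + 1 ≤ a → 1 ≤ j → j ≤ a →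
      s i (xv a j) =
        if j = i then -xv a (i + 1) else if j = i + 1 then -xv a i else -xv a j)
    (d : ℕ → OPol a →+ OPol a)
    (hd1 : ∀ i : ℕ, 1 ≤ i → i + 1 ≤ a → d i 1 = 0)
    (hdx : ∀ i j : ℕ, 1 ≤ i → i + 1 ≤ a → 1 ≤ j → j ≤ a →
      d i (xv a j) = if j = i ∨ j = i + 1 then 1 else 0)
    (hdL : ∀ i : ℕ, 1 ≤ i → i + 1 ≤ a → ∀ f g : OPol a,
      d i (f * g) = d i f * g + s i f * d i g)
    (W0 : OPol a →+* OPol a)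
    (hW0 : ∀ i : Fin a, W0 (OX i) = (-1 : OPol a) ^ Nat.choose a 2 * OX (Fin.rev i)) :
    (∀ f : OPol a, ∀ i : ℕ, 1 ≤ i → i + 1 ≤ a → d i (oddSymzn a d W0 f) = 0) ∧
    (∀ f : OPol a, (∀ i : ℕ, 1 ≤ i → i + 1 ≤ a → d i f = 0) → oddSymzn a d W0 f = f) ∧
    (∀ f : OPol a, oddSymzn a d W0 (oddSymzn a d W0 f) = oddSymzn a d W0 f) ∧
    (∀ f g : OPol a, (∀ i : ℕ, 1 ≤ i → i + 1 ≤ a → d i f = 0) →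
      oddSymzn a d W0 (f * g) = f * oddSymzn a d W0 g) := by
  have S : OddSystem a (xv a) s d :=
    ⟨fun i j => OPol.xv_anticomm, fun C => OPol.induction, hs, hdx, hdL⟩
  refine S.symmetrization (T := AddMonoid.End (OPol a)) (fun m => OPol.exists_separating
    OPol.mulLeftHom_injective OPol.isUnit_parityEnd OPol.parityEnd_mul_mulLeftHom) (W := W0) (fun j h1 h2 => ?_)
    (fun f => ?_)
  · rw [OPol.xv_of_le h1 h2, hW0, OPol.xv_of_le (by omega) (by omega)]
    congr 2
    rw [Fin.ext_iff, Fin.val_rev]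
    simp only
    omega
  · rw [oddSymzn, OPol.dword_eq_addWord, OPol.xdelta_eq_stair]
end
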